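/- arXiv:1607.02986 — 3 statements merged into one kernel-verified Lean document; each statement's English description precedes it below -/
import Mathlib

section
/- Let G = (X, Y, Q, Σ_X, Σ_Y, P) be a two-prover game with val(G) = 1 − ε, ε > 0, in which Q is the uniform distribution over a set E ⊆ X × Y with maximum degree d_max. Let 0 ≤ k ≤ |X|, 0 ≤ l ≤ |Y|, set s = k·l·|E|/(d_max·|X|·|Y|), let δ ∈ [0, 1/2], let β ∈ (0, δ/40], and let r = β·s/d_max be a positive integer with r ≤ min(k, l). If val(G^{⊗r}) ≤ (1 − ε/2)^R for some real R with 0 ≤ R ≤ r, δ ≤ ε·R/(200·r), and R ≤ δ^2·r/(1000·β·ε), then val(G^{k×l}) ≤ 2·(1 − ε/2)^{R/10}. -/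
open Finset

attribute [local instance] Classical.propDecidable

noncomputable section

/-- The value of a two-prover game with question sets `QX`, `QY`, answer sets `AX`, `AY`,
question distribution `Q` and verification predicate `P`. -/
def gameVal {QX QY AX AY : Type*} [Fintype QX] [Fintype QY] [Fintype AX] [Fintype AY]
    [Nonempty AX] [Nonempty AY] (Q : QX → QY → ℝ) (P : QX → QY → AX → AY → Prop) : ℝ :=
  (Finset.univ : Finset ((QX → AX) × (QY → AY))).sup'
    ⟨(fun _ => Classical.arbitrary AX, fun _ => Classical.arbitrary AY), Finset.mem_univ _⟩
    fun φ => ∑ x : QX, ∑ y : QY, Q x y * (if P x y (φ.1 x) (φ.2 y) then 1 else 0)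

/-- The uniform distribution over a finite set `E` of question pairs. -/
def unifOn {QX QY : Type*} (E : Finset (QX × QY)) : QX → QY → ℝ :=
  fun x y => if (x, y) ∈ E then (E.card : ℝ)⁻¹ else 0

/-- Maximum degree of a vertex in the bipartite graph `(X, Y, E)`. -/
def maxDeg {X Y : Type*} [Fintype X] [Fintype Y] (E : Finset (X × Y)) : ℕ :=
  max (Finset.univ.sup fun x : X => (E.filter fun e => e.1 = x).card)
      (Finset.univ.sup fun y : Y => (E.filter fun e => e.2 = y).card)

/-- The predicate of a birthday-repetition game: all edges between `S` and `T` must be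
answered acceptably. -/
def bPred {X Y AX AY : Type*} (E : Finset (X × Y)) (P : X → Y → AX → AY → Prop) :
    Finset X → Finset Y → (X → AX) → (Y → AY) → Prop :=
  fun S T a b => ∀ x ∈ S, ∀ y ∈ T, (x, y) ∈ E → P x y (a x) (b y)

/-- Value of the `(k × l)`-birthday repetition `G^{k×l}`: questions are uniformly random
`k`-subsets of `X` and `l`-subsets of `Y`. -/
def birthdayVal {X Y AX AY : Type*} [Fintype X] [Fintype Y] [Fintype AX] [Fintype AY]
    [Nonempty AX] [Nonempty AY] (E : Finset (X × Y)) (P : X → Y → AX → AY → Prop)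
    (k l : ℕ) : ℝ :=
  gameVal
    (fun (S : Finset X) (T : Finset Y) =>
      if S.card = k ∧ T.card = l then
        (((Fintype.card X).choose k : ℝ) * ((Fintype.card Y).choose l : ℝ))⁻¹
      else 0)
    (bPred E P)

/-- Value of the `r`-fold parallel repetition `G^{⊗r}`. -/
def parVal {X Y AX AY : Type*} [Fintype X] [Fintype Y] [Fintype AX] [Fintype AY]
    [Nonempty AX] [Nonempty AY] (Q : X → Y → ℝ) (P : X → Y → AX → AY → Prop) (r : ℕ) : ℝ :=
  gameVal (fun (xs : Fin r → X) (ys : Fin r → Y) => ∏ i, Q (xs i) (ys i))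
    (fun xs ys (a : Fin r → AX) (b : Fin r → AY) => ∀ i, P (xs i) (ys i) (a i) (b i))

/-- `E^r_set` : tuples of `r` edges of `E` whose endpoints are all distinct. -/
def ErSet {X Y : Type*} [Fintype X] [Fintype Y] (E : Finset (X × Y)) (r : ℕ) :
    Finset ((Fin r → X) × (Fin r → Y)) :=
  Finset.univ.filter fun p =>
    (∀ i, (p.1 i, p.2 i) ∈ E) ∧ Function.Injective p.1 ∧ Function.Injective p.2

/-- Value of `G^{⊗r}_set are`, the parallel repetition with question distribution uniform
over `E^r_set`. -/
def parSetVal {X Y AX AY : Type*} [Fintype X] [Fintype Y] [Fintype AX] [Fintype AY]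
    [Nonempty AX] [Nonempty AY] (E : Finset (X × Y)) (P : X → Y → AX → AY → Prop)
    (r : ℕ) : ℝ :=
  gameVal (fun xs ys => if (xs, ys) ∈ ErSet E r then ((ErSet E r).card : ℝ)⁻¹ else 0)
    (fun xs ys (a : Fin r → AX) (b : Fin r → AY) => ∀ i, P (xs i) (ys i) (a i) (b i))

/-- The distribution `Q^{k×l}_em`: sample a tuple of `r` disjoint edges uniformly from
`E^r_set`, then complete the endpoints to a uniformly random `k`-subset of `X` and
`l`-subset of `Y`. -/
def Qem {X Y : Type*} [Fintype X] [Fintype Y] (E : Finset (X × Y)) (r k l : ℕ) :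
    Finset X → Finset Y → ℝ :=
  fun S T =>
    ((ErSet E r).card : ℝ)⁻¹ *
      ∑ p ∈ ErSet E r,
        (if S.card = k ∧ T.card = l ∧ (∀ i, p.1 i ∈ S) ∧ (∀ i, p.2 i ∈ T) then
            (((Fintype.card X - r).choose (k - r) : ℝ) *
              ((Fintype.card Y - r).choose (l - r) : ℝ))⁻¹
          else 0)

/-- Value of `G^{k×l}_em`. -/
def birthdayEmVal {X Y AX AY : Type*} [Fintype X] [Fintype Y] [Fintype AX] [Fintype AY]
    [Nonempty AX] [Nonempty AY] (E : Finset (X × Y)) (P : X → Y → AX → AY → Prop)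
    (r k l : ℕ) : ℝ :=
  gameVal (Qem E r k l) (bPred E P)

/-- `|E(S, T)|`, the number of edges between `S` and `T`. -/
def edgeCount {X Y : Type*} (E : Finset (X × Y)) (S : Finset X) (T : Finset Y) : ℕ :=
  (E.filter fun e => e.1 ∈ S ∧ e.2 ∈ T).card

/-- The event `(1 - δ)·s ≤ |E(S,T)| ≤ (1 + δ)·s`. -/
def inRange {X Y : Type*} (E : Finset (X × Y)) (s δ : ℝ) (S : Finset X) (T : Finset Y) :
    Prop :=
  (1 - δ) * s ≤ (edgeCount E S T : ℝ) ∧ (edgeCount E S T : ℝ) ≤ (1 + δ) * s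

/-- Conditioning a distribution on an event `A`. -/
def condOn {QX QY : Type*} [Fintype QX] [Fintype QY] (Q : QX → QY → ℝ)
    (A : QX → QY → Prop) : QX → QY → ℝ :=
  fun x y =>
    if A x y then Q x y / (∑ x' : QX, ∑ y' : QY, if A x' y' then Q x' y' else 0) else 0

/-- Value of `G^{k×l}_{em,[s₁,s₂]}`. -/
def birthdayEmCondVal {X Y AX AY : Type*} [Fintype X] [Fintype Y] [Fintype AX] [Fintype AY]
    [Nonempty AX] [Nonempty AY] (E : Finset (X × Y)) (P : X → Y → AX → AY → Prop)
    (r k l : ℕ) (s δ : ℝ) : ℝ :=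
  gameVal (condOn (Qem E r k l) (inRange E s δ)) (bPred E P)

/-- The set `E^{k×l}_{[s₁,s₂]}` of pairs `(S, T)` with `|S| = k`, `|T| = l` and
`(1-δ)·s ≤ |E(S,T)| ≤ (1+δ)·s`. -/
def rangeSet {X Y : Type*} [Fintype X] [Fintype Y] (E : Finset (X × Y)) (k l : ℕ)
    (s δ : ℝ) : Finset (Finset X × Finset Y) :=
  Finset.univ.filter fun p => p.1.card = k ∧ p.2.card = l ∧ inRange E s δ p.1 p.2

/-- Value of `G^{k×l}_{[s₁,s₂]}`. -/
def birthdayRangeVal {X Y AX AY : Type*} [Fintype X] [Fintype Y] [Fintype AX] [Fintype AY]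
    [Nonempty AX] [Nonempty AY] (E : Finset (X × Y)) (P : X → Y → AX → AY → Prop)
    (k l : ℕ) (s δ : ℝ) : ℝ :=
  gameVal
    (fun S T => if (S, T) ∈ rangeSet E k l s δ then ((rangeSet E k l s δ).card : ℝ)⁻¹ else 0)
    (bPred E P)

/-- The `l`-th elementary symmetric sum of `f` over `s`. -/
def elemSum {α : Type*} (f : α → ℝ) (s : Finset α) (l : ℕ) : ℝ :=
  ∑ T ∈ s.powersetCard l, ∏ i ∈ T, f i

theorem elemSum_nonneg {α : Type*} {f : α → ℝ} (hf : ∀ i, 0 ≤ f i) (s : Finset α) (l : ℕ) :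
    0 ≤ elemSum f s l :=
  Finset.sum_nonneg fun _ _ => Finset.prod_nonneg fun i _ => hf i

theorem elemSum_insert {α : Type*} (f : α → ℝ) {s : Finset α} {a : α} (ha : a ∉ s) (l : ℕ) :
    elemSum f (insert a s) (l + 1) = elemSum f s (l + 1) + f a * elemSum f s l := by
  unfold elemSum
  rw [Finset.powersetCard_succ_insert ha, Finset.sum_union, Finset.sum_image, Finset.mul_sum]
  · congr 1
    refine Finset.sum_congr rfl fun T hT => ?_
    rw [Finset.prod_insert fun h => ha ((Finset.mem_powersetCard.1 hT).1 h)]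
  · intro T hT U hU h
    have hT' : a ∉ T := fun h => ha ((Finset.mem_powersetCard.1 hT).1 h)
    have hU' : a ∉ U := fun h => ha ((Finset.mem_powersetCard.1 hU).1 h)
    rw [← Finset.erase_insert hT', ← Finset.erase_insert hU']
    exact congrArg (fun V => Finset.erase V a) h
  · rw [Finset.disjoint_left]
    intro T hT hT'
    obtain ⟨U, _, rfl⟩ := Finset.mem_image.1 hT'
    exact ha ((Finset.mem_powersetCard.1 hT).1 (Finset.mem_insert_self _ _))

theorem sum_mul_elemSum_erase {α : Type*} (f : α → ℝ) (s : Finset α) (l : ℕ) :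
    ∑ i ∈ s, f i * elemSum f (s.erase i) l = (l + 1) * elemSum f s (l + 1) := by
  have h : ∀ T ∈ s.powersetCard (l + 1),
      ((l : ℝ) + 1) * ∏ i ∈ T, f i = ∑ i ∈ T, ∏ j ∈ T, f j := by
    intro T hT
    rw [Finset.sum_const, (Finset.mem_powersetCard.1 hT).2, nsmul_eq_mul]
    push_cast
    rfl
  simp only [elemSum]
  rw [Finset.mul_sum, Finset.sum_congr rfl h]
  simp only [Finset.mul_sum]
  rw [Finset.sum_sigma', Finset.sum_sigma']
  refine Finset.sum_bij' (fun p _ => ⟨insert p.1 p.2, p.1⟩) (fun p _ => ⟨p.2, p.1.erase p.2⟩)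
    ?_ ?_ ?_ ?_ ?_
  · rintro ⟨i, T⟩ h
    simp only [Finset.mem_sigma, Finset.mem_powersetCard, Finset.subset_erase] at h ⊢
    exact ⟨⟨Finset.insert_subset h.1 h.2.1.1, by rw [Finset.card_insert_of_notMem h.2.1.2, h.2.2]⟩,
      Finset.mem_insert_self _ _⟩
  · rintro ⟨T, i⟩ h
    simp only [Finset.mem_sigma, Finset.mem_powersetCard] at h ⊢
    exact ⟨h.1.1 h.2, Finset.erase_subset_erase _ h.1.1,
      by rw [Finset.card_erase_of_mem h.2, h.1.2]; rfl⟩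
  · rintro ⟨i, T⟩ h
    simp only [Finset.mem_sigma, Finset.mem_powersetCard, Finset.subset_erase] at h
    simp [Finset.erase_insert h.2.1.2]
  · rintro ⟨T, i⟩ h
    simp only [Finset.mem_sigma, Finset.mem_powersetCard] at h
    simp [Finset.insert_erase h.2]
  · rintro ⟨i, T⟩ h
    simp only [Finset.mem_sigma, Finset.mem_powersetCard, Finset.subset_erase] at h
    simp [Finset.prod_insert h.2.1.2]

theorem sum_elemSum_erase {α : Type*} (f : α → ℝ) (s : Finset α) (l : ℕ) :
    ∑ i ∈ s, elemSum f (s.erase i) l = ((s.card : ℝ) - l) * elemSum f s l := by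
  simp only [elemSum]
  rw [Finset.sum_comm' (t' := s.powersetCard l) (s' := fun T => s \ T), Finset.mul_sum]
  · refine Finset.sum_congr rfl fun T hT => ?_
    obtain ⟨hTs, hTl⟩ := Finset.mem_powersetCard.1 hT
    rw [Finset.sum_const, nsmul_eq_mul, Finset.cast_card_sdiff hTs, hTl]
  · intro i T
    simp only [Finset.mem_powersetCard, Finset.subset_erase, Finset.mem_sdiff]
    tauto

theorem antivaryOn_elemSum_erase {α : Type*} {f : α → ℝ} (hf : ∀ i, 0 ≤ f i) (s : Finset α)
    (l : ℕ) : AntivaryOn f (fun i => elemSum f (s.erase i) l) s := by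
  intro i hi j hj hij
  cases l with
  | zero => simp [elemSum] at hij
  | succ l =>
    by_contra! hlt
    have hne : i ≠ j := by rintro rfl; exact lt_irrefl _ hlt
    have h₁ : s.erase i = insert j ((s.erase i).erase j) :=
      (Finset.insert_erase (Finset.mem_erase.2 ⟨hne.symm, hj⟩)).symm
    have h₂ : s.erase j = insert i ((s.erase i).erase j) := by
      rw [Finset.erase_right_comm, Finset.insert_erase (Finset.mem_erase.2 ⟨hne, hi⟩)]
    simp only at hij
    rw [h₁, h₂, elemSum_insert f (by simp), elemSum_insert f (by simp)] at hij
    nlinarith [elemSum_nonneg hf ((s.erase i).erase j) l]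

/-- Maclaurin's inequality comparing the `l`-th elementary symmetric mean with the power of the
arithmetic mean. -/
theorem elemSum_le_choose_mul_pow {α : Type*} {f : α → ℝ} (hf : ∀ i, 0 ≤ f i) (s : Finset α)
    {l : ℕ} (hl : l ≤ s.card) :
    elemSum f s l ≤ (s.card.choose l : ℝ) * ((∑ i ∈ s, f i) / s.card) ^ l := by
  induction l with
  | zero => simp [elemSum]
  | succ l ih =>
    have hm : (0 : ℝ) < s.card := by exact_mod_cast (Nat.succ_pos l).trans_le hl
    have hlm : (0 : ℝ) ≤ (s.card : ℝ) - l := by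
      rw [sub_nonneg]; exact_mod_cast (Nat.le_succ l).trans hl
    have hc := (antivaryOn_elemSum_erase hf s l).card_mul_sum_le_sum_mul_sum
    rw [sum_mul_elemSum_erase, sum_elemSum_erase] at hc
    have hch : (s.card.choose (l + 1) : ℝ) * (l + 1) = s.card.choose l * ((s.card : ℝ) - l) := by
      rw [← Nat.cast_sub ((Nat.le_succ l).trans hl)]
      exact_mod_cast Nat.choose_succ_right_eq s.card l
    have hS : 0 ≤ ∑ i ∈ s, f i := Finset.sum_nonneg fun i _ => hf i
    have hl1 : (0 : ℝ) < (l : ℝ) + 1 := by positivity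
    refine le_of_mul_le_mul_left ?_ (mul_pos hm hl1)
    calc (s.card : ℝ) * (l + 1) * elemSum f s (l + 1)
        ≤ (∑ i ∈ s, f i) * (((s.card : ℝ) - l) * elemSum f s l) := by linarith
      _ ≤ (∑ i ∈ s, f i) * (((s.card : ℝ) - l) *
            ((s.card.choose l : ℝ) * ((∑ i ∈ s, f i) / s.card) ^ l)) := by
          gcongr
          exact ih ((Nat.le_succ l).trans hl)
      _ = (∑ i ∈ s, f i) * ((s.card.choose l * ((s.card : ℝ) - l)) *
            ((∑ i ∈ s, f i) / s.card) ^ l) := by ring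
      _ = _ := by
          rw [← hch, pow_succ]
          field_simp

theorem exp_neg_mul_le {u w : ℝ} (hu : 0 ≤ u) (hw0 : 0 ≤ w) (hw1 : w ≤ 1) :
    Real.exp (-(u * w)) ≤ 1 - u / (1 + u) * w := by
  have h := convexOn_exp.2 (Set.mem_univ (-u)) (Set.mem_univ 0) hw0 (sub_nonneg.2 hw1)
    (by ring)
  have h' : Real.exp (-u) ≤ (1 + u)⁻¹ := by
    rw [Real.exp_neg]
    exact inv_anti₀ (by positivity) (by linarith [Real.add_one_le_exp u])
  have h'' : (1 + u)⁻¹ = 1 - u / (1 + u) := by field_simp; ring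
  simp only [smul_eq_mul, mul_zero, add_zero, Real.exp_zero, mul_one] at h
  rw [show -(u * w) = w * -u by ring]
  nlinarith [mul_le_mul_of_nonneg_left h' hw0]

theorem exp_neg_le_one_sub_half {x : ℝ} (hx0 : 0 ≤ x) (hx1 : x ≤ 1) :
    Real.exp (-x) ≤ 1 - x / 2 := by
  have h := exp_neg_mul_le hx0 zero_le_one le_rfl
  rw [mul_one, mul_one] at h
  refine h.trans (sub_le_sub_left ?_ 1)
  exact div_le_div_of_nonneg_left hx0 (by positivity) (by linarith)

/-- Laplace transform of a sum sampled without replacement from values in `[0, 1]`. -/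
theorem sum_exp_powersetCard_le {α : Type*} (s : Finset α) (w : α → ℝ) (hw0 : ∀ i, 0 ≤ w i)
    (hw1 : ∀ i, w i ≤ 1) {u : ℝ} (hu : 0 ≤ u) {l : ℕ} (hl : l ≤ s.card) :
    ∑ T ∈ s.powersetCard l, Real.exp (-(u * ∑ i ∈ T, w i)) ≤
      (s.card.choose l : ℝ) * Real.exp (-(l / s.card * (u / (1 + u)) * ∑ i ∈ s, w i)) := by
  have h := elemSum_le_choose_mul_pow (f := fun i => Real.exp (-(u * w i)))
    (fun i => (Real.exp_pos _).le) s hl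
  have h₁ : elemSum (fun i => Real.exp (-(u * w i))) s l =
      ∑ T ∈ s.powersetCard l, Real.exp (-(u * ∑ i ∈ T, w i)) := by
    refine Finset.sum_congr rfl fun T _ => ?_
    rw [← Real.exp_sum, Finset.sum_neg_distrib, Finset.mul_sum]
  rw [h₁] at h
  refine h.trans (mul_le_mul_of_nonneg_left ?_ (Nat.cast_nonneg _))
  rcases Nat.eq_zero_or_pos s.card with h0 | hpos
  · have : l = 0 := by omega
    simp [this]
  have hm : (0 : ℝ) < s.card := by exact_mod_cast hpos
  have hmean : (∑ i ∈ s, Real.exp (-(u * w i))) / s.card ≤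
      Real.exp (-(u / (1 + u) * (∑ i ∈ s, w i) / s.card)) := by
    have h₂ : ∑ i ∈ s, Real.exp (-(u * w i)) ≤ s.card - u / (1 + u) * ∑ i ∈ s, w i := by
      calc _ ≤ ∑ i ∈ s, (1 - u / (1 + u) * w i) :=
            Finset.sum_le_sum fun i _ => exp_neg_mul_le hu (hw0 i) (hw1 i)
        _ = _ := by simp [Finset.mul_sum]
    calc _ ≤ (s.card - u / (1 + u) * ∑ i ∈ s, w i) / s.card := by gcongr
      _ = -(u / (1 + u) * (∑ i ∈ s, w i) / s.card) + 1 := by field_simp; ring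
      _ ≤ _ := Real.add_one_le_exp _
  calc _ ≤ Real.exp (-(u / (1 + u) * (∑ i ∈ s, w i) / s.card)) ^ l :=
        pow_le_pow_left₀ (div_nonneg (Finset.sum_nonneg fun _ _ => (Real.exp_pos _).le) hm.le)
          hmean l
    _ = _ := by
        rw [← Real.exp_nat_mul]
        congr 1
        ring

theorem sum_card_filter_eq {α β : Type*} (E : Finset α) (f : α → β) (S : Finset β) :
    ∑ b ∈ S, (E.filter fun e => f e = b).card = (E.filter fun e => f e ∈ S).card := by
  have h : Set.MapsTo f (E.filter fun e => f e ∈ S) S := fun e he => (Finset.mem_filter.1 he).2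
  rw [Finset.card_eq_sum_card_fiberwise h]
  refine Finset.sum_congr rfl fun b hb => ?_
  rw [Finset.filter_filter]
  congr 1
  ext e
  simp only [Finset.mem_filter]
  constructor
  · rintro ⟨h, rfl⟩; exact ⟨h, hb, rfl⟩
  · rintro ⟨h, _, rfl⟩; exact ⟨h, rfl⟩

section Graph

variable {X Y : Type*} [Fintype X] [Fintype Y]

theorem card_filter_fst_le_maxDeg (E : Finset (X × Y)) (x : X) :
    (E.filter fun e => e.1 = x).card ≤ maxDeg E :=
  (Finset.le_sup (f := fun x : X => (E.filter fun e => e.1 = x).card)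
    (Finset.mem_univ x)).trans (le_max_left _ _)

theorem card_filter_snd_le_maxDeg (E : Finset (X × Y)) (y : Y) :
    (E.filter fun e => e.2 = y).card ≤ maxDeg E :=
  (Finset.le_sup (f := fun y : Y => (E.filter fun e => e.2 = y).card)
    (Finset.mem_univ y)).trans (le_max_right _ _)

theorem maxDeg_mono {E F : Finset (X × Y)} (h : F ⊆ E) : maxDeg F ≤ maxDeg E :=
  max_le_max
    (Finset.sup_mono_fun fun _ _ => Finset.card_le_card (Finset.filter_subset_filter _ h))
    (Finset.sup_mono_fun fun _ _ => Finset.card_le_card (Finset.filter_subset_filter _ h))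

theorem maxDeg_pos {E : Finset (X × Y)} (hE : E.Nonempty) : 0 < maxDeg E := by
  obtain ⟨e, he⟩ := hE
  have h : e ∈ E.filter fun f => f.1 = e.1 := Finset.mem_filter.2 ⟨he, rfl⟩
  exact (Finset.card_pos.2 ⟨e, h⟩).trans_le (card_filter_fst_le_maxDeg E e.1)

/-- Laplace transform of the number of edges between independent uniformly random subsets. -/
theorem sum_exp_edgeCount_le (E : Finset (X × Y)) {u : ℝ} (hu : 0 ≤ u) {k l : ℕ}
    (hk : k ≤ Fintype.card X) (hl : l ≤ Fintype.card Y) :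
    ∑ S ∈ (Finset.univ : Finset X).powersetCard k, ∑ T ∈ (Finset.univ : Finset Y).powersetCard l,
        Real.exp (-(u * ((edgeCount E S T : ℝ) / maxDeg E))) ≤
      ((Fintype.card X).choose k : ℝ) * (Fintype.card Y).choose l *
        Real.exp (-(k * l / (Fintype.card X * Fintype.card Y) * (u / (1 + u) ^ 2) *
          (E.card / maxDeg E))) := by
  set d : ℝ := (maxDeg E : ℝ) with hd
  have hd0 : 0 ≤ d := Nat.cast_nonneg _
  set n := Fintype.card X
  set m := Fintype.card Y
  set u' : ℝ := l / m * (u / (1 + u)) with hu'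
  have hu'0 : 0 ≤ u' := by positivity
  have hinner : ∀ S : Finset X, ∑ T ∈ (Finset.univ : Finset Y).powersetCard l,
      Real.exp (-(u * ((edgeCount E S T : ℝ) / d))) ≤
      (m.choose l : ℝ) * Real.exp (-(u' * ∑ x ∈ S, ((E.filter fun e => e.1 = x).card : ℝ) / d)) := by
    intro S
    have h := sum_exp_powersetCard_le (Finset.univ : Finset Y)
      (fun y => (((E.filter fun e => e.1 ∈ S).filter fun e => e.2 = y).card : ℝ) / d)
      (fun y => by positivity)
      (fun y => div_le_one_of_le₀ (by
        rw [hd]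
        exact_mod_cast (card_filter_snd_le_maxDeg _ y).trans
          (maxDeg_mono (Finset.filter_subset _ E))) hd0) hu (l := l) hl
    simp only [← Finset.sum_div, ← Nat.cast_sum, sum_card_filter_eq] at h ⊢
    simp only [Finset.filter_filter, Finset.mem_univ, and_true] at h
    exact h
  have houter := sum_exp_powersetCard_le (Finset.univ : Finset X)
      (fun x => ((E.filter fun e => e.1 = x).card : ℝ) / d) (fun x => by positivity)
      (fun x => div_le_one_of_le₀ (by
        rw [hd]; exact_mod_cast card_filter_fst_le_maxDeg _ x) hd0) hu'0 (l := k) hk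
  have hu'u : u' ≤ u := by
    have h1 : (l : ℝ) / m ≤ 1 := div_le_one_of_le₀ (by exact_mod_cast hl) (by positivity)
    have h2 : u / (1 + u) ≤ u := div_le_self hu (by linarith)
    calc u' ≤ 1 * u := by rw [hu']; gcongr
      _ = u := one_mul u
  have htot : ∑ x : X, ((E.filter fun e => e.1 = x).card : ℝ) / d = E.card / d := by
    rw [← Finset.sum_div, ← Nat.cast_sum, sum_card_filter_eq]
    simp
  rw [htot] at houter
  calc _ ≤ ∑ S ∈ (Finset.univ : Finset X).powersetCard k, (m.choose l : ℝ) *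
          Real.exp (-(u' * ∑ x ∈ S, ((E.filter fun e => e.1 = x).card : ℝ) / d)) :=
        Finset.sum_le_sum fun S _ => hinner S
    _ ≤ (m.choose l : ℝ) * (n.choose k * Real.exp (-(k / n * (u' / (1 + u')) * (E.card / d)))) := by
        rw [← Finset.mul_sum]
        exact mul_le_mul_of_nonneg_left houter (Nat.cast_nonneg _)
    _ ≤ (m.choose l : ℝ) * (n.choose k * Real.exp (-(k / n * (u' / (1 + u)) * (E.card / d)))) := by
        gcongr
    _ = _ := by
        rw [hu', ← mul_assoc, mul_comm (m.choose l : ℝ)]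
        congr 3
        field_simp

/-- Lower-tail Chernoff bound for the number of edges between random subsets. -/
theorem card_edgeCount_lt_le {E : Finset (X × Y)} (hE : E.Nonempty) {k l : ℕ}
    (hk : k ≤ Fintype.card X) (hl : l ≤ Fintype.card Y) {s δ : ℝ} (hδ : 0 ≤ δ)
    (hs : s * maxDeg E = k * l * E.card / (Fintype.card X * Fintype.card Y)) :
    ∑ S ∈ (Finset.univ : Finset X).powersetCard k, ∑ T ∈ (Finset.univ : Finset Y).powersetCard l,
        (if (edgeCount E S T : ℝ) < (1 - δ) * (s * maxDeg E) then (1 : ℝ) else 0) ≤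
      ((Fintype.card X).choose k : ℝ) * (Fintype.card Y).choose l *
        Real.exp (-(δ ^ 2 * s / 8)) := by
  have hd : (0 : ℝ) < maxDeg E := by exact_mod_cast maxDeg_pos hE
  have hs0 : 0 ≤ s := by
    refine nonneg_of_mul_nonneg_left ?_ hd
    rw [hs]; positivity
  set u : ℝ := δ / 4 with hu
  have hu0 : 0 ≤ u := by positivity
  have hlap := sum_exp_edgeCount_le E hu0 hk hl
  have hpt : ∀ S T, (if (edgeCount E S T : ℝ) < (1 - δ) * (s * maxDeg E) then (1 : ℝ) else 0) ≤
      Real.exp (u * ((1 - δ) * s)) * Real.exp (-(u * ((edgeCount E S T : ℝ) / maxDeg E))) := by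
    intro S T
    split_ifs with h
    · rw [← Real.exp_add]
      refine Real.one_le_exp ?_
      have : (edgeCount E S T : ℝ) / maxDeg E ≤ (1 - δ) * s := by
        rw [div_le_iff₀ hd]; linarith
      nlinarith
    · positivity
  have hexp : (k : ℝ) * l / (Fintype.card X * Fintype.card Y) * (u / (1 + u) ^ 2) *
      (E.card / maxDeg E) = s * (u / (1 + u) ^ 2) := by
    have : s = k * l * E.card / (Fintype.card X * Fintype.card Y) / maxDeg E := by
      rw [← hs]; field_simp
    rw [this]; ring
  rw [hexp] at hlap
  have hfrac : u * (1 - 2 * u) ≤ u / (1 + u) ^ 2 := by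
    rw [le_div_iff₀ (by positivity)]
    have : 0 ≤ u ^ 3 * (3 + 2 * u) := by positivity
    nlinarith
  calc _ ≤ ∑ S ∈ (Finset.univ : Finset X).powersetCard k,
          ∑ T ∈ (Finset.univ : Finset Y).powersetCard l, Real.exp (u * ((1 - δ) * s)) *
            Real.exp (-(u * ((edgeCount E S T : ℝ) / maxDeg E))) :=
        Finset.sum_le_sum fun S _ => Finset.sum_le_sum fun T _ => hpt S T
    _ ≤ Real.exp (u * ((1 - δ) * s)) * (((Fintype.card X).choose k : ℝ) *
          (Fintype.card Y).choose l * Real.exp (-(s * (u / (1 + u) ^ 2)))) := by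
        simp only [← Finset.mul_sum]
        exact mul_le_mul_of_nonneg_left hlap (Real.exp_pos _).le
    _ = ((Fintype.card X).choose k : ℝ) * (Fintype.card Y).choose l *
          Real.exp (u * ((1 - δ) * s) - s * (u / (1 + u) ^ 2)) := by
        rw [sub_eq_add_neg _ (s * _), Real.exp_add]; ring
    _ ≤ _ := by
        refine mul_le_mul_of_nonneg_left (Real.exp_le_exp.2 ?_) (by positivity)
        have := mul_le_mul_of_nonneg_left hfrac hs0
        rw [hu] at this ⊢
        nlinarith

theorem card_filter_disjoint_edge (F : Finset (X × Y)) (e : X × Y) :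
    F.card ≤ (F.filter fun f => f.1 ≠ e.1 ∧ f.2 ≠ e.2).card + 2 * maxDeg F := by
  have h : F ⊆ (F.filter fun f => f.1 ≠ e.1 ∧ f.2 ≠ e.2) ∪
      ((F.filter fun f => f.1 = e.1) ∪ F.filter fun f => f.2 = e.2) := by
    intro f hf
    simp only [Finset.mem_union, Finset.mem_filter, hf, true_and]
    tauto
  have h₁ := (Finset.card_le_card h).trans (Finset.card_union_le _ _)
  have h₂ := Finset.card_union_le (F.filter fun f => f.1 = e.1) (F.filter fun f => f.2 = e.2)
  have h₃ := card_filter_fst_le_maxDeg F e.1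
  have h₄ := card_filter_snd_le_maxDeg F e.2
  omega

/-- Greedy lower bound on the number of ordered `r`-matchings of a bipartite graph. -/
theorem pow_le_card_ErSet {d : ℕ} {M : ℝ} (hM : 0 ≤ M) (r : ℕ) (F : Finset (X × Y))
    (hd : maxDeg F ≤ d) (hF : M + 2 * d * r ≤ F.card) : M ^ r ≤ ((ErSet F r).card : ℝ) := by
  induction r generalizing F with
  | zero =>
    have : (Fin.elim0, Fin.elim0) ∈ ErSet F 0 := by
      simp [ErSet, Function.Injective]
    simpa using Finset.card_pos.2 ⟨_, this⟩
  | succ r ih =>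
    let G : X × Y → Finset (X × Y) := fun e => F.filter fun f => f.1 ≠ e.1 ∧ f.2 ≠ e.2
    have hG : ∀ e, M ^ r ≤ ((ErSet (G e) r).card : ℝ) := by
      intro e
      refine ih (G e) ((maxDeg_mono (Finset.filter_subset _ F)).trans hd) ?_
      have h : (F.card : ℝ) ≤ (G e).card + 2 * maxDeg F := by
        exact_mod_cast card_filter_disjoint_edge F e
      have hd' : (maxDeg F : ℝ) ≤ d := by exact_mod_cast hd
      push_cast at hF
      linarith
    have hcard : ∑ e ∈ F, (ErSet (G e) r).card ≤ (ErSet F (r + 1)).card := by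
      rw [← Finset.card_sigma]
      refine Finset.card_le_card_of_injOn
        (fun p => (Fin.cons p.1.1 p.2.1, Fin.cons p.1.2 p.2.2)) ?_ ?_
      · rintro ⟨e, xs, ys⟩ hp
        simp only [ErSet, G, Finset.coe_sigma, Set.mem_sigma_iff, Finset.mem_coe,
          Finset.mem_filter, Finset.mem_univ, true_and] at hp ⊢
        obtain ⟨he, hedge, hx, hy⟩ := hp
        refine ⟨Fin.cases he fun i => (hedge i).1, ?_, ?_⟩
        · refine Fin.cons_injective_iff.2 ⟨?_, hx⟩
          rintro ⟨i, hi⟩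
          exact (hedge i).2.1 hi
        · refine Fin.cons_injective_iff.2 ⟨?_, hy⟩
          rintro ⟨i, hi⟩
          exact (hedge i).2.2 hi
      · rintro ⟨⟨x, y⟩, xs, ys⟩ _ ⟨⟨x', y'⟩, xs', ys'⟩ _ h
        simp only [Prod.mk.injEq] at h
        obtain ⟨rfl, rfl⟩ := Fin.cons_injective2 h.1
        obtain ⟨rfl, rfl⟩ := Fin.cons_injective2 h.2
        rfl
    have hMF : M ≤ F.card := by
      have : (0 : ℝ) ≤ 2 * d * (r + 1 : ℕ) := by positivity
      linarith
    calc M ^ (r + 1) = M * M ^ r := pow_succ' M r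
      _ ≤ F.card * M ^ r := by gcongr
      _ = ∑ _e ∈ F, M ^ r := by simp
      _ ≤ ∑ e ∈ F, ((ErSet (G e) r).card : ℝ) := Finset.sum_le_sum fun e _ => hG e
      _ ≤ _ := by exact_mod_cast hcard

end Graph

section Strategies

variable {QX QY AX AY : Type*} [Fintype QX] [Fintype QY] [Fintype AX] [Fintype AY]
  [Nonempty AX] [Nonempty AY]

theorem le_gameVal (Q : QX → QY → ℝ) (P : QX → QY → AX → AY → Prop) (φ : QX → AX) (ψ : QY → AY) :
    ∑ x, ∑ y, Q x y * (if P x y (φ x) (ψ y) then 1 else 0) ≤ gameVal Q P :=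
  Finset.le_sup' (fun φ : (QX → AX) × (QY → AY) =>
    ∑ x, ∑ y, Q x y * (if P x y (φ.1 x) (φ.2 y) then (1 : ℝ) else 0)) (Finset.mem_univ (φ, ψ))

theorem exists_deterministic_ge {I : Type*} [Fintype I] {p : QX → I → ℝ} (hp0 : ∀ x i, 0 ≤ p x i)
    (hp1 : ∀ x, ∑ i, p x i ≤ 1) (f : QX → I → AX) {c : QX → AX → ℝ} (hc : ∀ x a, 0 ≤ c x a) :
    ∃ φ : QX → AX, ∑ x, ∑ i, p x i * c x (f x i) ≤ ∑ x, c x (φ x) := by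
  choose φ hφ using fun x => Finite.exists_max (c x)
  refine ⟨φ, Finset.sum_le_sum fun x _ => ?_⟩
  calc ∑ i, p x i * c x (f x i) ≤ ∑ i, p x i * c x (φ x) :=
        Finset.sum_le_sum fun i _ => mul_le_mul_of_nonneg_left (hφ x _) (hp0 x i)
    _ = (∑ i, p x i) * c x (φ x) := by rw [Finset.sum_mul]
    _ ≤ 1 * c x (φ x) := mul_le_mul_of_nonneg_right (hp1 x) (hc x _)
    _ = _ := one_mul _

/-- Randomised strategies do not beat the value of a game. -/
theorem sum_randomized_le_gameVal {I J : Type*} [Fintype I] [Fintype J] {Q : QX → QY → ℝ}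
    (hQ : ∀ x y, 0 ≤ Q x y) (P : QX → QY → AX → AY → Prop)
    {p : QX → I → ℝ} (hp0 : ∀ x i, 0 ≤ p x i) (hp1 : ∀ x, ∑ i, p x i ≤ 1) (f : QX → I → AX)
    {q : QY → J → ℝ} (hq0 : ∀ y j, 0 ≤ q y j) (hq1 : ∀ y, ∑ j, q y j ≤ 1) (g : QY → J → AY) :
    ∑ x, ∑ i, ∑ y, ∑ j, p x i * (q y j * (Q x y * if P x y (f x i) (g y j) then 1 else 0)) ≤
      gameVal Q P := by
  have hterm : ∀ x y a b, 0 ≤ Q x y * (if P x y a b then (1 : ℝ) else 0) := fun x y a b =>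
    mul_nonneg (hQ x y) (by positivity)
  obtain ⟨φ, hφ⟩ := exists_deterministic_ge hp0 hp1 f
    (c := fun x a => ∑ y, ∑ j, q y j * (Q x y * if P x y a (g y j) then 1 else 0))
    (fun x a => Finset.sum_nonneg fun y _ => Finset.sum_nonneg fun j _ =>
      mul_nonneg (hq0 y j) (hterm _ _ _ _))
  obtain ⟨ψ, hψ⟩ := exists_deterministic_ge hq0 hq1 g
    (c := fun y b => ∑ x, Q x y * if P x y (φ x) b then 1 else 0)
    (fun y b => Finset.sum_nonneg fun x _ => hterm _ _ _ _)
  calc _ = ∑ x, ∑ i, p x i *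
          ∑ y, ∑ j, q y j * (Q x y * if P x y (f x i) (g y j) then 1 else 0) := by
        simp only [Finset.mul_sum]
    _ ≤ _ := hφ
    _ = ∑ y, ∑ j, q y j * ∑ x, Q x y * (if P x y (φ x) (g y j) then 1 else 0) := by
        rw [Finset.sum_comm]
        refine Finset.sum_congr rfl fun y _ => ?_
        rw [Finset.sum_comm]
        simp only [Finset.mul_sum]
    _ ≤ _ := hψ
    _ = ∑ x, ∑ y, Q x y * (if P x y (φ x) (ψ y) then 1 else 0) := Finset.sum_comm
    _ ≤ _ := le_gameVal Q P φ ψ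

end Strategies

/-- The uniform distribution over the `k`-subsets containing all entries of an injective tuple,
and zero for tuples with repetitions. -/
def extensionWeight {X : Type*} [Fintype X] {r : ℕ} (k : ℕ) (xs : Fin r → X) (S : Finset X) : ℝ :=
  if Function.Injective xs ∧ S.card = k ∧ ∀ i, xs i ∈ S then
    (((Fintype.card X - r).choose (k - r) : ℕ) : ℝ)⁻¹ else 0

theorem sum_extensionWeight_le_one {X : Type*} [Fintype X] {r : ℕ} (k : ℕ) (xs : Fin r → X) :
    ∑ S, extensionWeight k xs S ≤ 1 := by
  by_cases hxs : Function.Injective xs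
  · let A : Finset X := Finset.univ.image xs
    have hA : A.card = r := by
      rw [Finset.card_image_of_injective _ hxs, Finset.card_univ, Fintype.card_fin]
    have hcard : (Finset.univ.filter fun S : Finset X => S.card = k ∧ ∀ i, xs i ∈ S).card ≤
        (Fintype.card X - r).choose (k - r) := by
      have hX : (Finset.univ \ A).card = Fintype.card X - r := by
        rw [Finset.card_sdiff_of_subset (Finset.subset_univ A), hA, Finset.card_univ]
      rw [← hX, ← Finset.card_powersetCard]
      have hsub : ∀ S : Finset X, (∀ i, xs i ∈ S) → A ⊆ S := fun S h =>
        Finset.image_subset_iff.2 fun i _ => h i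
      refine Finset.card_le_card_of_injOn (fun S => S \ A) ?_ ?_
      · intro S hS
        obtain ⟨hSk, hS⟩ := (Finset.mem_filter.1 hS).2
        exact Finset.mem_powersetCard.2 ⟨Finset.sdiff_subset_sdiff (Finset.subset_univ _) subset_rfl,
          by rw [Finset.card_sdiff_of_subset (hsub S hS), hSk, hA]⟩
      · intro S hS T hT h
        have hS' := hsub S (Finset.mem_filter.1 hS).2.2
        have hT' := hsub T (Finset.mem_filter.1 hT).2.2
        rw [← Finset.sdiff_union_of_subset hS', ← Finset.sdiff_union_of_subset hT']
        exact congrArg (· ∪ A) h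
    simp only [extensionWeight, hxs, true_and]
    rw [← Finset.sum_filter, Finset.sum_const, nsmul_eq_mul, ← div_eq_mul_inv]
    exact div_le_one_of_le₀ (by exact_mod_cast hcard) (Nat.cast_nonneg _)
  · simp [extensionWeight, hxs]

theorem extensionWeight_nonneg {X : Type*} [Fintype X] {r : ℕ} (k : ℕ) (xs : Fin r → X)
    (S : Finset X) : 0 ≤ extensionWeight k xs S := by
  unfold extensionWeight
  positivity

theorem pow_mul_choose_sub_le {n k r : ℕ} (hrk : r ≤ k) (hkn : k ≤ n) :
    n ^ r * (n - r).choose (k - r) ≤ k ^ r * n.choose k := by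
  induction r with
  | zero => simp
  | succ r ih =>
    obtain ⟨a, rfl⟩ := Nat.exists_eq_add_of_le hrk
    obtain ⟨b, rfl⟩ := Nat.exists_eq_add_of_le hkn
    have ih := ih (by omega)
    rw [show r + 1 + a + b - r = a + b + 1 by omega, show r + 1 + a - r = a + 1 by omega] at ih
    rw [show r + 1 + a + b - (r + 1) = a + b by omega, show r + 1 + a - (r + 1) = a by omega]
    have hstep := Nat.add_one_mul_choose_eq (a + b) a
    refine Nat.le_of_mul_le_mul_left ?_ (Nat.succ_pos (a + b))
    have hcross : (r + 1 + a + b) * (a + 1) ≤ (a + b + 1) * (r + 1 + a) := by nlinarith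
    calc (a + b + 1) * ((r + 1 + a + b) ^ (r + 1) * (a + b).choose a)
        = (r + 1 + a + b) ^ (r + 1) * ((a + b + 1) * (a + b).choose a) := by ring
      _ = ((r + 1 + a + b) * (a + 1)) *
            ((r + 1 + a + b) ^ r * (a + b + 1).choose (a + 1)) := by rw [hstep]; ring
      _ ≤ ((a + b + 1) * (r + 1 + a)) *
            ((r + 1 + a) ^ r * (r + 1 + a + b).choose (r + 1 + a)) := Nat.mul_le_mul hcross ih
      _ = _ := by rw [Nat.succ_eq_add_one]; ring

section Birthday

variable {X Y AX AY : Type*} [Fintype X] [Fintype Y] [Fintype AX] [Fintype AY]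
  [Nonempty AX] [Nonempty AY]

/-- Embedding parallel repetition into birthday repetition: a family `W` of winning question pairs
each spanning many `r`-matchings is bounded by the value of the parallel repetition. -/
theorem card_mul_le_parVal {E : Finset (X × Y)} (P : X → Y → AX → AY → Prop) {k l r : ℕ}
    (a : Finset X → X → AX) (b : Finset Y → Y → AY) (W : Finset (Finset X × Finset Y)) {N : ℝ}
    (hW : ∀ w ∈ W, w.1.card = k ∧ w.2.card = l ∧ bPred E P w.1 w.2 (a w.1) (b w.2) ∧
      N ≤ (ErSet (E.filter fun e => e.1 ∈ w.1 ∧ e.2 ∈ w.2) r).card) :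
    W.card * (N * (((E.card : ℝ)⁻¹) ^ r *
      ((((Fintype.card X - r).choose (k - r) : ℕ) : ℝ)⁻¹ *
        (((Fintype.card Y - r).choose (l - r) : ℕ) : ℝ)⁻¹))) ≤ parVal (unifOn E) P r := by
  set κ : ℝ := ((E.card : ℝ)⁻¹) ^ r * ((((Fintype.card X - r).choose (k - r) : ℕ) : ℝ)⁻¹ *
        (((Fintype.card Y - r).choose (l - r) : ℕ) : ℝ)⁻¹) with hκ
  have hκ0 : 0 ≤ κ := by positivity
  have hQ0 : ∀ x y, 0 ≤ unifOn E x y := fun x y => by unfold unifOn; positivity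
  have hmix := sum_randomized_le_gameVal (QX := Fin r → X) (QY := Fin r → Y)
    (Q := fun xs ys => ∏ i, unifOn E (xs i) (ys i))
    (fun xs ys => Finset.prod_nonneg fun i _ => hQ0 _ _)
    (fun xs ys (a : Fin r → AX) (b : Fin r → AY) => ∀ i, P (xs i) (ys i) (a i) (b i))
    (p := extensionWeight k) (extensionWeight_nonneg k) (sum_extensionWeight_le_one k)
    (fun xs S i => a S (xs i))
    (q := extensionWeight l) (extensionWeight_nonneg l) (sum_extensionWeight_le_one l)
    (fun ys T i => b T (ys i))
  refine le_trans ?_ hmix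
  let t : Finset X × Finset Y → (Fin r → X) × (Fin r → Y) → ℝ := fun w z =>
    extensionWeight k z.1 w.1 * (extensionWeight l z.2 w.2 * ((∏ i, unifOn E (z.1 i) (z.2 i)) *
      if ∀ i, P (z.1 i) (z.2 i) (a w.1 (z.1 i)) (b w.2 (z.2 i)) then 1 else 0))
  have ht0 : ∀ w z, 0 ≤ t w z := fun w z =>
    mul_nonneg (extensionWeight_nonneg _ _ _) (mul_nonneg (extensionWeight_nonneg _ _ _)
      (mul_nonneg (Finset.prod_nonneg fun i _ => hQ0 _ _) (by positivity)))
  have ht : ∀ w ∈ W, ∀ z ∈ ErSet (E.filter fun e => e.1 ∈ w.1 ∧ e.2 ∈ w.2) r, t w z = κ := by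
    intro w hw z hz
    obtain ⟨hwk, hwl, hwin, _⟩ := hW w hw
    simp only [ErSet, Finset.mem_filter, Finset.mem_univ, true_and] at hz
    obtain ⟨hzE, hz1, hz2⟩ := hz
    have hP : ∀ i, P (z.1 i) (z.2 i) (a w.1 (z.1 i)) (b w.2 (z.2 i)) := fun i =>
      hwin _ (hzE i).2.1 _ (hzE i).2.2 (hzE i).1
    have h1 : extensionWeight k z.1 w.1 = (((Fintype.card X - r).choose (k - r) : ℕ) : ℝ)⁻¹ :=
      if_pos ⟨hz1, hwk, fun i => (hzE i).2.1⟩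
    have h2 : extensionWeight l z.2 w.2 = (((Fintype.card Y - r).choose (l - r) : ℕ) : ℝ)⁻¹ :=
      if_pos ⟨hz2, hwl, fun i => (hzE i).2.2⟩
    have h3 : ∀ i, unifOn E (z.1 i) (z.2 i) = (E.card : ℝ)⁻¹ := fun i => if_pos (hzE i).1
    simp only [t, h1, h2, h3, if_pos hP, Finset.prod_const, Finset.card_univ, Fintype.card_fin]
    rw [hκ]
    ring
  calc (W.card : ℝ) * (N * κ) = ∑ _w ∈ W, N * κ := by simp
    _ ≤ ∑ w ∈ W, ∑ z ∈ ErSet (E.filter fun e => e.1 ∈ w.1 ∧ e.2 ∈ w.2) r, t w z := by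
        refine Finset.sum_le_sum fun w hw => ?_
        rw [Finset.sum_congr rfl (ht w hw), Finset.sum_const, nsmul_eq_mul]
        exact mul_le_mul_of_nonneg_right (hW w hw).2.2.2 hκ0
    _ ≤ ∑ w ∈ W, ∑ z, t w z := Finset.sum_le_sum fun w _ =>
        Finset.sum_le_sum_of_subset_of_nonneg (Finset.subset_univ _) fun z _ _ => ht0 w z
    _ ≤ ∑ w, ∑ z, t w z :=
        Finset.sum_le_sum_of_subset_of_nonneg (Finset.subset_univ _) fun w _ _ =>
          Finset.sum_nonneg fun z _ => ht0 w z
    _ = _ := by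
        rw [Finset.sum_comm]
        simp only [Fintype.sum_prod_type, t]
        refine Finset.sum_congr rfl fun xs _ => ?_
        rw [Finset.sum_comm]
        congr!

/-- If each pair of `W` is winning and spans at least `θ` times the expected number of edges plus
`2 · maxDeg · r`, then `W` has density at most `θ⁻ʳ` times the value of the parallel repetition. -/
theorem card_mul_pow_le_parVal_mul {E : Finset (X × Y)} (hE : E.Nonempty)
    (P : X → Y → AX → AY → Prop) {k l r : ℕ} (hk : k ≤ Fintype.card X) (hl : l ≤ Fintype.card Y)
    (hr : 0 < r) (hrk : r ≤ k) (hrl : r ≤ l)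
    (a : Finset X → X → AX) (b : Finset Y → Y → AY) (W : Finset (Finset X × Finset Y)) {θ : ℝ}
    (hθ : 0 ≤ θ)
    (hW : ∀ w ∈ W, w.1.card = k ∧ w.2.card = l ∧ bPred E P w.1 w.2 (a w.1) (b w.2) ∧
      θ * (k * l * E.card / (Fintype.card X * Fintype.card Y)) + 2 * maxDeg E * r ≤
        edgeCount E w.1 w.2) :
    W.card * θ ^ r ≤ parVal (unifOn E) P r *
      ((Fintype.card X).choose k * (Fintype.card Y).choose l) := by
  set s : ℝ := k * l * E.card / (Fintype.card X * Fintype.card Y) with hs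
  have hs0 : 0 ≤ s := by positivity
  have hmain := card_mul_le_parVal P (k := k) (l := l) a b W (N := (θ * s) ^ r) fun w hw => by
    obtain ⟨h₁, h₂, h₃, h₄⟩ := hW w hw
    exact ⟨h₁, h₂, h₃, pow_le_card_ErSet (mul_nonneg hθ hs0) r _
      (maxDeg_mono (Finset.filter_subset _ _)) h₄⟩
  have hEc : (0 : ℝ) < E.card := by exact_mod_cast hE.card_pos
  have hk0 : (0 : ℝ) < k := by exact_mod_cast hr.trans_le hrk
  have hl0 : (0 : ℝ) < l := by exact_mod_cast hr.trans_le hrl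
  have hn0 : (0 : ℝ) < Fintype.card X := hk0.trans_le (by exact_mod_cast hk)
  have hm0 : (0 : ℝ) < Fintype.card Y := hl0.trans_le (by exact_mod_cast hl)
  have hc₁ : (0 : ℝ) < ((Fintype.card X - r).choose (k - r) : ℕ) := by
    exact_mod_cast Nat.choose_pos (by omega)
  have hc₂ : (0 : ℝ) < ((Fintype.card Y - r).choose (l - r) : ℕ) := by
    exact_mod_cast Nat.choose_pos (by omega)
  have hb₁ : (Fintype.card X : ℝ) ^ r * ((Fintype.card X - r).choose (k - r) : ℕ) ≤
      (k : ℝ) ^ r * (Fintype.card X).choose k := by exact_mod_cast pow_mul_choose_sub_le hrk hk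
  have hb₂ : (Fintype.card Y : ℝ) ^ r * ((Fintype.card Y - r).choose (l - r) : ℕ) ≤
      (l : ℝ) ^ r * (Fintype.card Y).choose l := by exact_mod_cast pow_mul_choose_sub_le hrl hl
  have hb := mul_le_mul hb₁ hb₂ (by positivity) (by positivity)
  set c₁ : ℝ := (((Fintype.card X - r).choose (k - r) : ℕ) : ℝ)
  set c₂ : ℝ := (((Fintype.card Y - r).choose (l - r) : ℕ) : ℝ)
  have hpv : 0 ≤ parVal (unifOn E) P r := le_trans (by positivity) hmain
  have heq : (W.card : ℝ) * ((θ * s) ^ r * (((E.card : ℝ)⁻¹) ^ r * (c₁⁻¹ * c₂⁻¹))) =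
      W.card * θ ^ r * ((k : ℝ) ^ r * (l : ℝ) ^ r) /
        ((Fintype.card X : ℝ) ^ r * c₁ * ((Fintype.card Y : ℝ) ^ r * c₂)) := by
    rw [hs, mul_pow, div_pow, mul_pow, mul_pow, mul_pow, inv_pow]
    field_simp
  rw [heq, div_le_iff₀ (by positivity)] at hmain
  have hkl : (0 : ℝ) < (k : ℝ) ^ r * (l : ℝ) ^ r := by positivity
  refine le_of_mul_le_mul_right ?_ hkl
  calc _ ≤ _ := hmain
    _ ≤ parVal (unifOn E) P r * ((k : ℝ) ^ r * (Fintype.card X).choose k *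
          ((l : ℝ) ^ r * (Fintype.card Y).choose l)) := mul_le_mul_of_nonneg_left hb hpv
    _ = _ := by ring

theorem gameVal_unifOn_nonneg (E : Finset (X × Y)) (P : X → Y → AX → AY → Prop) :
    0 ≤ gameVal (unifOn E) P :=
  le_trans (Finset.sum_nonneg fun x _ => Finset.sum_nonneg fun y _ =>
      mul_nonneg (by unfold unifOn; positivity) (by positivity))
    (le_gameVal (unifOn E) P (fun _ => Classical.arbitrary AX) fun _ => Classical.arbitrary AY)

/-- The value of birthday repetition is at most the density of pairs `(S, T)` spanning atypically
few edges plus the largest density of typical winning pairs. -/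
theorem birthdayVal_le {E : Finset (X × Y)} {P : X → Y → AX → AY → Prop} {k l : ℕ}
    (hk : k ≤ Fintype.card X) (hl : l ≤ Fintype.card Y) {M A B : ℝ}
    (hbad : ∑ S ∈ (Finset.univ : Finset X).powersetCard k,
        ∑ T ∈ (Finset.univ : Finset Y).powersetCard l,
          (if (edgeCount E S T : ℝ) < M then (1 : ℝ) else 0) ≤
      ((Fintype.card X).choose k : ℝ) * (Fintype.card Y).choose l * A)
    (hgood : ∀ (a : Finset X → X → AX) (b : Finset Y → Y → AY),
      ((Finset.univ.filter fun w : Finset X × Finset Y => w.1.card = k ∧ w.2.card = l ∧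
        bPred E P w.1 w.2 (a w.1) (b w.2) ∧ M ≤ edgeCount E w.1 w.2).card : ℝ) ≤
      ((Fintype.card X).choose k : ℝ) * (Fintype.card Y).choose l * B) :
    birthdayVal E P k l ≤ A + B := by
  set C : ℝ := ((Fintype.card X).choose k : ℝ) * (Fintype.card Y).choose l with hC
  have hC0 : 0 < C := by
    have h₁ := Nat.choose_pos hk
    have h₂ := Nat.choose_pos hl
    positivity
  unfold birthdayVal gameVal
  refine Finset.sup'_le _ _ fun φ _ => ?_
  have hsum : ∑ S ∈ (Finset.univ : Finset X).powersetCard k,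
        ∑ T ∈ (Finset.univ : Finset Y).powersetCard l,
          (if (edgeCount E S T : ℝ) < M then (1 : ℝ) else 0) =
      ∑ S, ∑ T, if S.card = k ∧ T.card = l ∧ (edgeCount E S T : ℝ) < M then (1 : ℝ) else 0 := by
    simp only [Finset.powersetCard_eq_filter, Finset.sum_filter, Finset.powerset_univ, ite_and]
    refine Finset.sum_congr rfl fun S _ => ?_
    split_ifs <;> simp
  rw [hsum] at hbad
  have hgood' := hgood φ.1 φ.2
  rw [Finset.card_filter, Nat.cast_sum, Fintype.sum_prod_type] at hgood'
  refine le_of_mul_le_mul_left ?_ hC0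
  calc _ = ∑ S, ∑ T, if S.card = k ∧ T.card = l ∧ bPred E P S T (φ.1 S) (φ.2 T)
          then (1 : ℝ) else 0 := by
        rw [Finset.mul_sum]
        refine Finset.sum_congr rfl fun S _ => ?_
        rw [Finset.mul_sum]
        refine Finset.sum_congr rfl fun T _ => ?_
        beta_reduce
        by_cases h : S.card = k ∧ T.card = l
        · by_cases h' : bPred E P S T (φ.1 S) (φ.2 T)
          · simp [h, h', ← hC, hC0.ne']
          · simp [h']
        · rw [if_neg h]
          simp only [zero_mul, mul_zero]
          exact (if_neg fun h' => h ⟨h'.1, h'.2.1⟩).symm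
    _ ≤ ∑ S, ∑ T, ((if S.card = k ∧ T.card = l ∧ (edgeCount E S T : ℝ) < M then (1 : ℝ) else 0) +
          ((if S.card = k ∧ T.card = l ∧ bPred E P S T (φ.1 S) (φ.2 T) ∧
            M ≤ (edgeCount E S T : ℝ) then 1 else 0 : ℕ) : ℝ)) := by
        refine Finset.sum_le_sum fun S _ => Finset.sum_le_sum fun T _ => ?_
        by_cases h : S.card = k ∧ T.card = l ∧ bPred E P S T (φ.1 S) (φ.2 T)
        · rw [if_pos h]
          obtain ⟨hS, hT, hP⟩ := h
          rcases lt_or_ge (edgeCount E S T : ℝ) M with h' | h'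
          · simp only [hS, hT, h', and_self, if_true]
            exact le_add_of_nonneg_right (Nat.cast_nonneg _)
          · simp [hS, hT, hP, h', not_lt.2 h']
        · rw [if_neg h]
          positivity
    _ ≤ C * A + C * B := by
        simp only [Finset.sum_add_distrib]
        exact add_le_add hbad hgood'
    _ = _ := by ring

end Birthday

/-- **Parameter-selection lemma.**  If `val(G) = 1 − ε` and the parallel repetition
satisfies `val(G^{⊗r}) ≤ (1 − ε/2)^R` where `0 ≤ R ≤ r`, `δ ≤ ε·R/(200·r)` and
`R ≤ δ²·r/(1000·β·ε)`, then `val(G^{k×l}) ≤ 2·(1 − ε/2)^{R/10}`. -/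
theorem birthday_parameter_selection {X Y AX AY : Type*}
    [Fintype X] [Fintype Y] [Fintype AX] [Fintype AY] [Nonempty AX] [Nonempty AY]
    (E : Finset (X × Y)) (hE : E.Nonempty) (P : X → Y → AX → AY → Prop)
    (ε : ℝ) (hε : 0 < ε) (hval : gameVal (unifOn E) P = 1 - ε)
    (k l : ℕ) (hk : k ≤ Fintype.card X) (hl : l ≤ Fintype.card Y)
    (s : ℝ)
    (hs : s = (k : ℝ) * (l : ℝ) * (E.card : ℝ) /
        ((maxDeg E : ℝ) * (Fintype.card X : ℝ) * (Fintype.card Y : ℝ)))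
    (δ : ℝ) (hδ0 : 0 ≤ δ) (hδ1 : δ ≤ 1 / 2)
    (β : ℝ) (hβ0 : 0 < β) (hβδ : β ≤ δ / 40)
    (r : ℕ) (hr0 : 0 < r) (hr : (r : ℝ) = β * s / (maxDeg E : ℝ)) (hrk : r ≤ k) (hrl : r ≤ l)
    (R : ℝ) (hR0 : 0 ≤ R) (hRr : R ≤ (r : ℝ))
    (hδR : δ ≤ ε * R / (200 * (r : ℝ)))
    (hRδ : R ≤ δ ^ 2 * (r : ℝ) / (1000 * β * ε))
    (hpar : parVal (unifOn E) P r ≤ (1 - ε / 2) ^ R) :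
    birthdayVal E P k l ≤ 2 * (1 - ε / 2) ^ (R / 10) := by
  have hε1 : ε ≤ 1 := by linarith [gameVal_unifOn_nonneg E P]
  have hd : (1 : ℝ) ≤ maxDeg E := by exact_mod_cast maxDeg_pos hE
  have hrpos : (0 : ℝ) < r := by exact_mod_cast hr0
  have hδpos : 0 < δ := by linarith
  set d : ℝ := (maxDeg E : ℝ) with hdd
  have hsd : s * d = k * l * E.card / (Fintype.card X * Fintype.card Y) := by
    rw [hs]; field_simp
  have hs0 : 0 ≤ s := by rw [hs]; positivity
  have hrd : (r : ℝ) * d = β * s := by rw [hr]; field_simp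
  have hδr : 200 * (δ * r) ≤ ε * R := by
    rw [le_div_iff₀ (by positivity)] at hδR
    linarith
  have hRs : 1000 * (ε * R) ≤ δ ^ 2 * s := by
    rw [le_div_iff₀ (by positivity)] at hRδ
    have hrs : (r : ℝ) ≤ β * s := by nlinarith
    have : β * (1000 * (ε * R)) ≤ β * (δ ^ 2 * s) := by
      nlinarith [mul_le_mul_of_nonneg_left hrs (sq_nonneg δ)]
    exact le_of_mul_le_mul_left this hβ0
  have hδsmall : 200 * δ ≤ 1 := by
    have : ε * R ≤ 1 * r := mul_le_mul hε1 hRr hR0 zero_le_one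
    nlinarith
  have hεR : 0 ≤ ε * R := mul_nonneg hε.le hR0
  set c : ℝ := 1 - ε / 2 with hc
  have hc0 : 0 < c := by rw [hc]; linarith
  have hexp_le : ∀ t : ℝ, 0 ≤ t → Real.exp (-(ε * t)) ≤ c ^ t := by
    intro t ht
    calc Real.exp (-(ε * t)) = Real.exp (-ε) ^ t := by rw [← Real.exp_mul]; ring_nf
      _ ≤ c ^ t := Real.rpow_le_rpow (Real.exp_pos _).le
          (exp_neg_le_one_sub_half hε.le hε1) ht
  have hle_exp : ∀ t : ℝ, 0 ≤ t → c ^ t ≤ Real.exp (-(ε * t / 2)) := by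
    intro t ht
    calc c ^ t ≤ Real.exp (-(ε / 2)) ^ t := by
          refine Real.rpow_le_rpow hc0.le ?_ ht
          linarith [Real.add_one_le_exp (-(ε / 2))]
      _ = _ := by rw [← Real.exp_mul]; ring_nf
  set θ : ℝ := 1 - δ - 2 * β with hθ
  have hθ0 : 0 ≤ θ := by rw [hθ]; linarith
  have hθexp : Real.exp (-(4 * δ)) ≤ θ := by
    refine (exp_neg_le_one_sub_half (by linarith) (by linarith)).trans ?_
    rw [hθ]; linarith
  have hchernoff := card_edgeCount_lt_le hE hk hl hδ0 hsd
  have htail : Real.exp (-(δ ^ 2 * s / 8)) ≤ c ^ (R / 10) := by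
    refine le_trans (Real.exp_le_exp.2 ?_) (hexp_le (R / 10) (by positivity))
    linarith
  have hC0 : (0 : ℝ) ≤ (Fintype.card X).choose k * (Fintype.card Y).choose l := by positivity
  rw [two_mul]
  refine birthdayVal_le hk hl
    (hchernoff.trans (mul_le_mul_of_nonneg_left htail hC0)) fun a b => ?_
  have hW := card_mul_pow_le_parVal_mul hE P hk hl hr0 hrk hrl a b
    (Finset.univ.filter fun w : Finset X × Finset Y => w.1.card = k ∧ w.2.card = l ∧
        bPred E P w.1 w.2 (a w.1) (b w.2) ∧ (1 - δ) * (s * d) ≤ edgeCount E w.1 w.2) hθ0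
    (fun w hw => by
      obtain ⟨h₁, h₂, h₃, h₄⟩ := (Finset.mem_filter.1 hw).2
      refine ⟨h₁, h₂, h₃, le_trans ?_ h₄⟩
      rw [← hsd, ← hdd, hθ]
      nlinarith [mul_nonneg (mul_nonneg hβ0.le hs0) (sub_nonneg.2 hd)])
  have hθpow : Real.exp (-(4 * δ * r)) ≤ θ ^ r := by
    calc Real.exp (-(4 * δ * r)) = Real.exp (-(4 * δ)) ^ r := by
          rw [← Real.exp_nat_mul]; ring_nf
      _ ≤ θ ^ r := pow_le_pow_left₀ (Real.exp_pos _).le hθexp r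
  have hratio : c ^ R ≤ c ^ (R / 10) * θ ^ r := by
    calc c ^ R = c ^ (R / 10) * c ^ (9 * R / 10) := by
          rw [← Real.rpow_add hc0]; ring_nf
      _ ≤ c ^ (R / 10) * Real.exp (-(4 * δ * r)) := by
          gcongr
          refine (hle_exp _ (by positivity)).trans (Real.exp_le_exp.2 ?_)
          linarith
      _ ≤ _ := by gcongr
  refine le_of_mul_le_mul_right ?_ ((Real.exp_pos _).trans_le hθpow)
  refine hW.trans ?_
  calc _ ≤ c ^ (R / 10) * θ ^ r * ((Fintype.card X).choose k * (Fintype.card Y).choose l) :=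
        mul_le_mul_of_nonneg_right (hpar.trans hratio) hC0
    _ = _ := by ring
end
end

section
/- There is a universal constant γ > 0 such that the following holds. Let G = (X, Y, Q, Σ_X, Σ_Y, P) be a projection game in which Q is the uniform distribution over a set E ⊆ X × Y, let d_max be the maximum degree of a vertex in the bipartite graph (X, Y, E), and suppose val(G) = 1 − ε. Then for every integer k ≥ 2 and every integer l ≥ 0 with k·l ≤ |X| and k·l ≤ |Y|, val(G^l_k) ≤ 2·(1 − ε/2)^{γ·ε^3·k^2·l^2·|E| / (d_max·|X|·|Y|)}. -/
open Finset

attribute [local instance] Classical.propDecidable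

noncomputable section

/-- Pairs `(S, T)` of an `l`-element subset of `X` and an `l`-element subset of `Y`:
the variables of the Max `k`-CSP instance `G^l_k`. -/
abbrev SubPairs (X Y : Type*) [Fintype X] [Fintype Y] (l : ℕ) :=
  {p : Finset X × Finset Y // p.1.card = l ∧ p.2.card = l}

/-- Value of the fully-dense Max `k`-CSP instance `G^l_k` obtained from a two-prover game
with edge set `E` and predicate `P`.  The alphabet value assigned to a variable `(S, T)` is
(represented by) a pair of functions `X → AX` and `Y → AY`; the predicate on a `k`-tuple of
variables checks pairwise consistency on shared vertices and that all edges of `E` between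
the union of the `S`-parts and the union of the `T`-parts are accepted. -/
def glkVal {X Y AX AY : Type*} [Fintype X] [Fintype Y] [Fintype AX] [Fintype AY]
    [Nonempty AX] [Nonempty AY] (E : Finset (X × Y)) (P : X → Y → AX → AY → Prop)
    (k l : ℕ) : ℝ :=
  (Finset.univ : Finset (SubPairs X Y l → (X → AX) × (Y → AY))).sup'
    ⟨fun _ => (fun _ => Classical.arbitrary AX, fun _ => Classical.arbitrary AY),
      Finset.mem_univ _⟩
    fun φ =>
      ∑ S : Fin k → SubPairs X Y l,
        ((Fintype.card (SubPairs X Y l) : ℝ) ^ k)⁻¹ *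
          (if (∀ i j : Fin k, ∀ a : X, a ∈ (S i).1.1 → a ∈ (S j).1.1 →
                  (φ (S i)).1 a = (φ (S j)).1 a) ∧
              (∀ i j : Fin k, ∀ b : Y, b ∈ (S i).1.2 → b ∈ (S j).1.2 →
                  (φ (S i)).2 b = (φ (S j)).2 b) ∧
              (∀ i j : Fin k, ∀ a ∈ (S i).1.1, ∀ b ∈ (S j).1.2, (a, b) ∈ E →
                  P a b ((φ (S i)).1 a) ((φ (S j)).2 b))
            then 1 else 0)

/-- Removing `b` elements from an `n`-element set shrinks the number of its `l`-element subsets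
at least by the factor `(1 - l / n) ^ b`. -/
lemma choose_sub_le {n l : ℕ} (hl : l ≤ n) (b : ℕ) (hb : b ≤ n) :
    ((n - b).choose l : ℝ) ≤ n.choose l * (1 - (l : ℝ) / n) ^ b := by
  have hq : 0 ≤ 1 - (l : ℝ) / n :=
    sub_nonneg.2 (div_le_one_of_le₀ (by exact_mod_cast hl) (Nat.cast_nonneg _))
  induction b with
  | zero => simp
  | succ b ih =>
    obtain ⟨N, hN⟩ : ∃ N, n - b = N + 1 := ⟨n - b - 1, by omega⟩
    have hN' : n - (b + 1) = N := by omega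
    have ih := ih (by omega)
    rw [hN] at ih
    rw [hN', pow_succ, ← mul_assoc]
    refine le_trans ?_ (mul_le_mul_of_nonneg_right ih hq)
    rcases lt_or_ge N l with h | h
    · rw [Nat.choose_eq_zero_of_lt h]
      simpa using mul_nonneg (Nat.cast_nonneg _) hq
    · have key := Nat.choose_mul_succ_eq N l
      have key' : (N.choose l : ℝ) * (N + 1) = (N + 1).choose l * (N + 1 - l) := by
        have := congrArg (Nat.cast : ℕ → ℝ) key
        rw [Nat.cast_mul, Nat.cast_mul, Nat.cast_sub (by omega)] at this
        exact_mod_cast this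
      have hpos : (0 : ℝ) < N + 1 := by positivity
      have hle : ((N : ℝ) + 1) ≤ n := by exact_mod_cast (by omega : N + 1 ≤ n)
      have heq : (N.choose l : ℝ) = (N + 1).choose l * (1 - (l : ℝ) / (N + 1)) := by
        field_simp
        linarith
      rw [heq]
      gcongr

lemma card_powersetCard_compl_le {α : Type*} [Fintype α] {l : ℕ} (hl : l ≤ Fintype.card α)
    (B : Finset α) :
    ((powersetCard l Bᶜ).card : ℝ) ≤
      (powersetCard l (univ : Finset α)).card * (1 - (l : ℝ) / Fintype.card α) ^ B.card := by
  rw [card_powersetCard, card_powersetCard, card_compl, card_univ]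
  exact choose_sub_le hl _ (card_le_univ _)

lemma card_subPairs {X Y : Type*} [Fintype X] [Fintype Y] (l : ℕ) :
    Fintype.card (SubPairs X Y l) =
      (powersetCard l (univ : Finset X)).card * (powersetCard l (univ : Finset Y)).card := by
  rw [← card_product, Fintype.card_subtype]
  congr 1
  ext p
  simp [mem_powersetCard]

lemma card_subPairs_disjoint_fst_le {X Y : Type*} [Fintype X] [Fintype Y] {l : ℕ}
    (hl : l ≤ Fintype.card X) (B : Finset X) :
    ((univ.filter fun v : SubPairs X Y l => Disjoint v.1.1 B).card : ℝ) ≤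
      Fintype.card (SubPairs X Y l) * (1 - (l : ℝ) / Fintype.card X) ^ B.card := by
  have h : (univ.filter fun v : SubPairs X Y l => Disjoint v.1.1 B).card ≤
      (powersetCard l Bᶜ ×ˢ powersetCard l (univ : Finset Y)).card := by
    refine card_le_card_of_injOn Subtype.val ?_ Subtype.val_injective.injOn
    intro v hv
    have hv' : Disjoint v.1.1 B := by simpa using hv
    simpa [mem_powersetCard, v.2.1, v.2.2] using le_compl_iff_disjoint_right.2 hv'
  rw [card_product] at h
  calc _ ≤ ((powersetCard l Bᶜ).card : ℝ) * (powersetCard l (univ : Finset Y)).card := by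
        exact_mod_cast h
    _ ≤ _ := by
        rw [card_subPairs, Nat.cast_mul, mul_right_comm]
        exact mul_le_mul_of_nonneg_right (card_powersetCard_compl_le hl B) (Nat.cast_nonneg _)

lemma card_subPairs_disjoint_snd_le {X Y : Type*} [Fintype X] [Fintype Y] {l : ℕ}
    (hl : l ≤ Fintype.card Y) (B : Finset Y) :
    ((univ.filter fun v : SubPairs X Y l => Disjoint v.1.2 B).card : ℝ) ≤
      Fintype.card (SubPairs X Y l) * (1 - (l : ℝ) / Fintype.card Y) ^ B.card := by
  have h : (univ.filter fun v : SubPairs X Y l => Disjoint v.1.2 B).card ≤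
      (powersetCard l (univ : Finset X) ×ˢ powersetCard l Bᶜ).card := by
    refine card_le_card_of_injOn Subtype.val ?_ Subtype.val_injective.injOn
    intro v hv
    have hv' : Disjoint v.1.2 B := by simpa using hv
    simpa [mem_powersetCard, v.2.1, v.2.2] using le_compl_iff_disjoint_right.2 hv'
  rw [card_product] at h
  calc _ ≤ ((powersetCard l (univ : Finset X)).card : ℝ) * (powersetCard l Bᶜ).card := by
        exact_mod_cast h
    _ ≤ _ := by
        rw [card_subPairs, Nat.cast_mul, mul_assoc]
        exact mul_le_mul_of_nonneg_left (card_powersetCard_compl_le hl B) (Nat.cast_nonneg _)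

/-- The moment method: an average over pairs is controlled by independent copies of the second
coordinate sharing the first one. -/
lemma sum_sum_pow_le {A C : Type*} [Fintype A] [Nonempty A] [Fintype C] (W : A → C → ℝ)
    (hW : ∀ a c, 0 ≤ W a c) (m : ℕ) :
    (∑ a, ∑ c, W a c) ^ (m + 1) ≤
      (Fintype.card A : ℝ) ^ m * ∑ c : Fin (m + 1) → C, ∑ a, ∏ s, W a (c s) := by
  have h := pow_sum_div_card_le_sum_pow (s := univ) (f := fun a => ∑ c, W a c)
    (fun a _ => sum_nonneg fun c _ => hW a c) m
  rw [div_le_iff₀ (by rw [card_univ]; exact pow_pos (by exact_mod_cast Fintype.card_pos) _)] at h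
  simp only [Fintype.sum_pow (ι := C), card_univ] at h
  rwa [sum_comm (s := (univ : Finset (Fin (m + 1) → C))), mul_comm]

lemma sum_prod_boole_eq {V : Type*} [Fintype V] (p : V → Prop) (k : ℕ) :
    ∑ a : Fin k → V, (if ∀ i, p (a i) then (1 : ℝ) else 0) =
      ((univ.filter p).card : ℝ) ^ k := by
  rw [← sum_boole, Fintype.sum_pow]
  refine sum_congr rfl fun a _ => ?_
  rw [prod_boole]
  simp

lemma sum_prod_boole_curry_eq {V : Type*} [Fintype V] (p : V → Prop) (k m : ℕ) :
    ∑ c : Fin m → Fin k → V, (if ∀ s j, p (c s j) then (1 : ℝ) else 0) =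
      (((univ.filter p).card : ℝ) ^ k) ^ m := by
  have h := sum_prod_boole_eq (V := Fin k → V) (fun a => ∀ j, p (a j)) m
  have h' := sum_prod_boole_eq p k
  rw [sum_boole] at h'
  rw [← h']
  convert h
  rfl

/-- Exponential moment of the weight of the set of points missed by a random family of sets. -/
lemma sum_exp_uncovered_le {V Y : Type*} [Fintype V] [Fintype Y] (T : V → Finset Y) {q : ℝ}
    (hq : 0 ≤ q)
    (hT : ∀ A : Finset Y,
      ((univ.filter fun v => Disjoint (T v) A).card : ℝ) ≤ Fintype.card V * q ^ A.card)
    (z : Y → ℝ) (hz0 : ∀ y, 0 ≤ z y) (hz1 : ∀ y, z y ≤ 1) (k m : ℕ) :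
    ∑ c : Fin m → Fin k → V,
        Real.exp (∑ y ∈ univ.filter fun y => ∀ s j, y ∉ T (c s j), z y) ≤
      ((Fintype.card V : ℝ) ^ k) ^ m * Real.exp (2 * (q ^ k) ^ m * ∑ y, z y) := by
  have hζ0 : ∀ y, 0 ≤ Real.exp (z y) - 1 := fun y => by
    linarith [Real.add_one_le_exp (z y), hz0 y]
  have hζ2 : ∀ y, Real.exp (z y) - 1 ≤ 2 * z y := fun y => by
    have := Real.abs_exp_sub_one_le (x := z y) (by rw [abs_of_nonneg (hz0 y)]; exact hz1 y)
    rwa [abs_of_nonneg (hζ0 y), abs_of_nonneg (hz0 y)] at this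
  have expand : ∀ c : Fin m → Fin k → V,
      Real.exp (∑ y ∈ univ.filter fun y => ∀ s j, y ∉ T (c s j), z y) =
        ∑ A : Finset Y, (∏ y ∈ A, (Real.exp (z y) - 1)) *
          (if ∀ s j, Disjoint (T (c s j)) A then 1 else 0) := by
    intro c
    rw [Real.exp_sum, prod_filter]
    have : ∀ y, (if ∀ s j, y ∉ T (c s j) then Real.exp (z y) else 1) =
        1 + (Real.exp (z y) - 1) * (if ∀ s j, y ∉ T (c s j) then 1 else 0) := by
      intro y; split_ifs <;> ring
    simp_rw [this]
    rw [prod_one_add, powerset_univ]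
    refine sum_congr rfl fun A _ => ?_
    rw [prod_mul_distrib, prod_boole]
    congr 2
    simp only [Finset.disjoint_right, eq_iff_iff]
    exact ⟨fun h s j y hy => h y hy s j, fun h y hy s j => h s j hy⟩
  simp_rw [expand]
  rw [sum_comm]
  calc ∑ A : Finset Y, ∑ c : Fin m → Fin k → V, (∏ y ∈ A, (Real.exp (z y) - 1)) *
          (if ∀ s j, Disjoint (T (c s j)) A then 1 else 0)
      ≤ ∑ A : Finset Y, ((Fintype.card V : ℝ) ^ k) ^ m *
          ∏ y ∈ A, ((Real.exp (z y) - 1) * (q ^ k) ^ m) := by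
        refine sum_le_sum fun A _ => ?_
        rw [← mul_sum, prod_mul_distrib, prod_const, mul_left_comm]
        refine mul_le_mul_of_nonneg_left ?_ (prod_nonneg fun y _ => hζ0 y)
        calc _ = (((univ.filter fun v => Disjoint (T v) A).card : ℝ) ^ k) ^ m := by
              convert sum_prod_boole_curry_eq (fun v => Disjoint (T v) A) k m
          _ ≤ ((Fintype.card V * q ^ A.card) ^ k) ^ m := by gcongr; exact hT A
          _ = _ := by rw [mul_pow, mul_pow]; ring
    _ = ((Fintype.card V : ℝ) ^ k) ^ m * ∏ y, (1 + (Real.exp (z y) - 1) * (q ^ k) ^ m) := by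
        rw [← mul_sum, prod_one_add, powerset_univ]
    _ ≤ _ := by
        refine mul_le_mul_of_nonneg_left ?_ (by positivity)
        rw [mul_sum, Real.exp_sum]
        refine prod_le_prod (fun y _ => ?_) fun y _ => ?_
        · have := hζ0 y; positivity
        · have h1 : (Real.exp (z y) - 1) * (q ^ k) ^ m ≤ 2 * z y * (q ^ k) ^ m :=
            mul_le_mul_of_nonneg_right (hζ2 y) (by positivity)
          calc _ ≤ 2 * (q ^ k) ^ m * z y + 1 := by linarith
            _ ≤ _ := Real.add_one_le_exp _

lemma card_filter_fst_eq_le_maxDeg {X Y : Type*} [Fintype X] [Fintype Y] (E : Finset (X × Y))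
    (x : X) : (E.filter fun e => e.1 = x).card ≤ maxDeg E :=
  le_max_of_le_left (le_sup (f := fun x : X => (E.filter fun e => e.1 = x).card) (mem_univ x))

lemma card_filter_snd_eq_le_maxDeg {X Y : Type*} [Fintype X] [Fintype Y] (E : Finset (X × Y))
    (y : Y) : (E.filter fun e => e.2 = y).card ≤ maxDeg E :=
  le_max_of_le_right (le_sup (f := fun y : Y => (E.filter fun e => e.2 = y).card) (mem_univ y))

lemma sum_unifOn_mul {X Y : Type*} [Fintype X] [Fintype Y] (E : Finset (X × Y))
    (p : X → Y → Prop) :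
    ∑ x, ∑ y, unifOn E x y * (if p x y then (1 : ℝ) else 0) =
      (E.card : ℝ)⁻¹ * (E.filter fun e => p e.1 e.2).card := by
  rw [← sum_boole, mul_sum, ← Fintype.sum_prod_type', ← sum_filter_add_sum_filter_not univ (· ∈ E)]
  rw [sum_eq_zero (s := univ.filter (· ∉ E))]
  · rw [add_zero]
    refine sum_congr (by ext; simp) fun e he => ?_
    simp [unifOn, he]
  · intro e he
    have : e ∉ E := by simpa using he
    simp [unifOn, this]

section Game

variable {X Y AX AY : Type*} [Fintype X] [Fintype Y] [Fintype AX] [Fintype AY]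
  [Nonempty AX] [Nonempty AY]

lemma card_satisfied_le {E : Finset (X × Y)} {P : X → Y → AX → AY → Prop} {ε : ℝ}
    (hE : E.Nonempty) (hval : gameVal (unifOn E) P = 1 - ε) (f : X → AX) (g : Y → AY) :
    ((E.filter fun e => P e.1 e.2 (f e.1) (g e.2)).card : ℝ) ≤ (1 - ε) * E.card := by
  have h : (E.card : ℝ)⁻¹ * (E.filter fun e => P e.1 e.2 (f e.1) (g e.2)).card ≤ 1 - ε := by
    rw [← hval, ← sum_unifOn_mul E fun x y => P x y (f x) (g y)]
    exact le_sup' (f := fun φ : (X → AX) × (Y → AY) =>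
      ∑ x, ∑ y, unifOn E x y * (if P x y (φ.1 x) (φ.2 y) then (1 : ℝ) else 0)) (mem_univ (f, g))
  have hpos : (0 : ℝ) < E.card := by exact_mod_cast hE.card_pos
  rwa [inv_mul_le_iff₀ hpos, mul_comm] at h

lemma gap_mem_Icc {E : Finset (X × Y)} {P : X → Y → AX → AY → Prop} {ε : ℝ}
    (hE : E.Nonempty) (hval : gameVal (unifOn E) P = 1 - ε) : 0 ≤ ε ∧ ε ≤ 1 := by
  have hpos : (0 : ℝ) < E.card := by exact_mod_cast hE.card_pos
  constructor
  · have : gameVal (unifOn E) P ≤ 1 := by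
      refine sup'_le _ _ fun φ _ => ?_
      rw [sum_unifOn_mul E fun x y => P x y (φ.1 x) (φ.2 y), inv_mul_le_iff₀ hpos, mul_one]
      exact_mod_cast card_filter_le _ _
    linarith
  · have := card_satisfied_le hE hval (fun _ => Classical.arbitrary AX)
      (fun _ => Classical.arbitrary AY)
    have h0 : 0 ≤ (1 - ε) * E.card := (Nat.cast_nonneg _).trans this
    linarith [nonneg_of_mul_nonneg_left h0 hpos]

/-- If a family of partial labelings of `Y` is jointly satisfiable at every `x ∉ B` and covers
every `y ∉ U`, then the edges touching `B` or `U` account for the gap of the game. -/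
lemma gap_le_of_partial_labelings {E : Finset (X × Y)} {P : X → Y → AX → AY → Prop} {ε : ℝ}
    (hE : E.Nonempty) (hval : gameVal (unifOn E) P = 1 - ε) {ι : Type*} (T : ι → Finset Y)
    (g : ι → Y → AY) :
    ε * E.card ≤
      maxDeg E * (univ.filter fun x =>
        ¬ ∃ a, ∀ i, ∀ y ∈ T i, (x, y) ∈ E → P x y a (g i y)).card +
      ∑ y ∈ univ.filter fun y => ∀ i, y ∉ T i, ((E.filter fun e => e.2 = y).card : ℝ) := by
  set B := univ.filter fun x => ¬ ∃ a, ∀ i, ∀ y ∈ T i, (x, y) ∈ E → P x y a (g i y) with hB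
  set U := univ.filter fun y => ∀ i, y ∉ T i with hU
  have hf : ∀ x, ∃ a, x ∉ B → ∀ i, ∀ y ∈ T i, (x, y) ∈ E → P x y a (g i y) := by
    intro x
    by_cases h : ∃ a, ∀ i, ∀ y ∈ T i, (x, y) ∈ E → P x y a (g i y)
    · exact h.imp fun a ha _ => ha
    · exact ⟨Classical.arbitrary AX, fun hx => absurd (by simpa [hB] using h) hx⟩
  have hg : ∀ y, ∃ b, y ∉ U → ∃ i, y ∈ T i ∧ g i y = b := by
    intro y
    by_cases h : ∃ i, y ∈ T i
    · obtain ⟨i, hi⟩ := h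
      exact ⟨g i y, fun _ => ⟨i, hi, rfl⟩⟩
    · exact ⟨Classical.arbitrary AY, fun hy => absurd (by simpa [hU] using h) hy⟩
  choose f hf using hf
  choose g' hg using hg
  have hsub : E ⊆ (E.filter fun e => P e.1 e.2 (f e.1) (g' e.2)) ∪
      ((B.biUnion fun x => E.filter fun e => e.1 = x) ∪
        U.biUnion fun y => E.filter fun e => e.2 = y) := by
    intro e he
    simp only [mem_union, mem_filter, mem_biUnion]
    by_cases h1 : e.1 ∈ B
    · exact Or.inr (Or.inl ⟨e.1, h1, he, rfl⟩)
    by_cases h2 : e.2 ∈ U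
    · exact Or.inr (Or.inr ⟨e.2, h2, he, rfl⟩)
    obtain ⟨i, hi, hgi⟩ := hg e.2 h2
    exact Or.inl ⟨he, hgi ▸ hf e.1 h1 i e.2 hi he⟩
  have hcard := (card_le_card hsub).trans ((card_union_le _ _).trans
    (Nat.add_le_add_left ((card_union_le _ _).trans (Nat.add_le_add
      (card_biUnion_le_card_mul _ _ _ fun x _ => card_filter_fst_eq_le_maxDeg E x)
      card_biUnion_le)) _))
  have hcard' : (E.card : ℝ) ≤ (E.filter fun e => P e.1 e.2 (f e.1) (g' e.2)).card +
      (B.card * maxDeg E + ∑ y ∈ U, ((E.filter fun e => e.2 = y).card : ℝ)) := by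
    exact_mod_cast hcard
  linarith [card_satisfied_le hE hval f g']

/-- The `m`-th moment bound for the bipartite game in which the first prover receives `k₁`
and the second prover receives `k₂` independent random sets. -/
lemma sum_win_pow_le {E : Finset (X × Y)} {P : X → Y → AX → AY → Prop} {ε : ℝ}
    (hE : E.Nonempty) (hval : gameVal (unifOn E) P = 1 - ε) {V : Type*} [Fintype V] [Nonempty V]
    (S : V → Finset X) (T : V → Finset Y) (f : V → X → AX) (g : V → Y → AY)
    {η q : ℝ} (hη : 0 ≤ η) (hq : 0 ≤ q) (k₁ k₂ m : ℕ) (hk₁ : k₁ * η ≤ 1)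
    (hS : ∀ A : Finset X, ((univ.filter fun v => Disjoint (S v) A).card : ℝ) ≤
      Fintype.card V * (1 - η) ^ A.card)
    (hT : ∀ A : Finset Y, ((univ.filter fun v => Disjoint (T v) A).card : ℝ) ≤
      Fintype.card V * q ^ A.card) :
    (∑ a : Fin k₁ → V, ∑ c : Fin k₂ → V,
        if ∀ i j, ∀ x ∈ S (a i), ∀ y ∈ T (c j), (x, y) ∈ E →
          P x y (f (a i) x) (g (c j) y) then (1 : ℝ) else 0) ^ (m + 1) ≤
      ((Fintype.card V : ℝ) ^ (k₁ + k₂)) ^ (m + 1) *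
        Real.exp (-(k₁ * η * (E.card / maxDeg E) * (ε - 2 * (q ^ k₂) ^ (m + 1)))) := by
  set d : ℝ := (maxDeg E : ℝ) with hd
  set N : ℝ := (Fintype.card V : ℝ) with hN
  obtain ⟨e₀, he₀⟩ := hE
  have hdpos : 0 < d := by
    rw [hd]
    have : e₀ ∈ E.filter fun e => e.1 = e₀.1 := mem_filter.2 ⟨he₀, rfl⟩
    exact_mod_cast (card_pos.2 ⟨e₀, this⟩).trans_le (card_filter_fst_eq_le_maxDeg E e₀.1)
  have hη1 : 0 ≤ 1 - η ∨ k₁ = 0 := by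
    rcases Nat.eq_zero_or_pos k₁ with h | h
    · exact Or.inr h
    · left
      have : (1 : ℝ) ≤ k₁ := by exact_mod_cast h
      nlinarith
  set deg : Y → ℝ := fun y => (E.filter fun e => e.2 = y).card with hdeg
  have hdegsum : ∑ y, deg y = E.card := by
    rw [hdeg, card_eq_sum_card_fiberwise (f := Prod.snd) (t := univ) (fun _ _ => by simp)]
    push_cast
    rfl
  set z : Y → ℝ := fun y => k₁ * η * (deg y / d) with hz
  set W : (Fin k₁ → V) → (Fin k₂ → V) → ℝ := fun a c =>
    if ∀ i j, ∀ x ∈ S (a i), ∀ y ∈ T (c j), (x, y) ∈ E →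
          P x y (f (a i) x) (g (c j) y) then (1 : ℝ) else 0 with hWdef
  have hinner : ∀ c : Fin (m + 1) → Fin k₂ → V, ∑ a, ∏ s, W a (c s) ≤
      N ^ k₁ * (Real.exp (-(k₁ * η * (E.card / d) * ε)) *
        Real.exp (∑ y ∈ univ.filter fun y => ∀ s j, y ∉ T (c s j), z y)) := by
    intro c
    have hgap := gap_le_of_partial_labelings ⟨e₀, he₀⟩ hval
      (fun ij : Fin (m + 1) × Fin k₂ => T (c ij.1 ij.2)) (fun ij => g (c ij.1 ij.2))
    simp only [Prod.forall] at hgap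
    set B := univ.filter fun x => ¬ ∃ a, ∀ s j, ∀ y ∈ T (c s j), (x, y) ∈ E →
      P x y a (g (c s j) y) with hB
    calc ∑ a, ∏ s, W a (c s)
        ≤ ∑ a : Fin k₁ → V, if ∀ i, Disjoint (S (a i)) B then (1 : ℝ) else 0 := by
          refine sum_le_sum fun a _ => ?_
          rw [hWdef, prod_boole]
          split_ifs with h1 h2
          · exact le_rfl
          · refine absurd (fun i => disjoint_left.2 fun x hx hxB => ?_) h2
            refine (mem_filter.1 hxB).2 ⟨f (a i) x, fun s j y hy hxy => ?_⟩
            exact h1 s (mem_univ s) i j x hx y hy hxy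
          · exact zero_le_one
          · exact le_rfl
      _ = ((univ.filter fun v => Disjoint (S v) B).card : ℝ) ^ k₁ := by
          convert sum_prod_boole_eq (fun v => Disjoint (S v) B) k₁
      _ ≤ (N * Real.exp (-(η * B.card))) ^ k₁ := by
          rcases hη1 with h | h
          · gcongr
            refine (hS B).trans ?_
            gcongr
            rw [show -(η * B.card) = B.card * -η by ring, Real.exp_nat_mul]
            gcongr
            exact Real.one_sub_le_exp_neg η
          · simp [h]
      _ = N ^ k₁ * Real.exp (-(k₁ * η * B.card)) := by
          rw [mul_pow, ← Real.exp_nat_mul]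
          ring_nf
      _ ≤ _ := by
          rw [← Real.exp_add]
          gcongr
          rw [hz, ← mul_sum, ← sum_div]
          have h1 : ε * (E.card / d) ≤ B.card +
              (∑ y ∈ univ.filter fun y => ∀ s j, y ∉ T (c s j), deg y) / d := by
            rw [← mul_div_assoc, div_le_iff₀ hdpos, add_mul, div_mul_cancel₀ _ hdpos.ne',
              mul_comm (B.card : ℝ)]
            exact hgap
          have h2 := mul_le_mul_of_nonneg_left h1 (by positivity : 0 ≤ k₁ * η)
          linarith
  have hz0 : ∀ y, 0 ≤ z y := fun y => by positivity
  have hz1 : ∀ y, z y ≤ 1 := fun y => by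
    refine mul_le_one₀ hk₁ (by positivity) (div_le_one_of_le₀ ?_ hdpos.le)
    simp only [hd, hdeg]
    exact_mod_cast card_filter_snd_eq_le_maxDeg E y
  calc (∑ a, ∑ c, W a c) ^ (m + 1)
      ≤ (Fintype.card (Fin k₁ → V) : ℝ) ^ m * ∑ c : Fin (m + 1) → Fin k₂ → V,
          ∑ a, ∏ s, W a (c s) :=
        sum_sum_pow_le W (fun a c => by simp only [hWdef]; split_ifs <;> norm_num) m
    _ ≤ (N ^ k₁) ^ m * ∑ c : Fin (m + 1) → Fin k₂ → V,
          N ^ k₁ * (Real.exp (-(k₁ * η * (E.card / d) * ε)) *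
            Real.exp (∑ y ∈ univ.filter fun y => ∀ s j, y ∉ T (c s j), z y)) := by
        rw [Fintype.card_fun, Fintype.card_fin, Nat.cast_pow]
        gcongr
        exact hinner _
    _ ≤ (N ^ k₁) ^ m * (N ^ k₁ * (Real.exp (-(k₁ * η * (E.card / d) * ε)) *
          ((N ^ k₂) ^ (m + 1) * Real.exp (2 * (q ^ k₂) ^ (m + 1) * ∑ y, z y)))) := by
        rw [← mul_sum, ← mul_sum]
        gcongr
        exact sum_exp_uncovered_le T hq hT z hz0 hz1 k₂ (m + 1)
    _ = _ := by
        rw [hz, ← mul_sum, ← sum_div, hdegsum]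
        rw [show -(k₁ * η * (E.card / d) * (ε - 2 * (q ^ k₂) ^ (m + 1))) =
          -(k₁ * η * (E.card / d) * ε) + 2 * (q ^ k₂) ^ (m + 1) * (k₁ * η * (E.card / d)) by ring,
          Real.exp_add]
        ring

lemma glkVal_le_one (E : Finset (X × Y)) (P : X → Y → AX → AY → Prop) (k l : ℕ) :
    glkVal E P k l ≤ 1 := by
  refine sup'_le _ _ fun φ _ => ?_
  calc _ ≤ ∑ S : Fin k → SubPairs X Y l, ((Fintype.card (SubPairs X Y l) : ℝ) ^ k)⁻¹ := by
        refine sum_le_sum fun S _ => mul_le_of_le_one_right (by positivity) ?_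
        split_ifs <;> norm_num
    _ ≤ 1 := by
        rw [sum_const, card_univ, Fintype.card_fun, Fintype.card_fin, nsmul_eq_mul, Nat.cast_pow]
        exact mul_inv_le_one

lemma glkVal_pow_le {E : Finset (X × Y)} {P : X → Y → AX → AY → Prop} {ε : ℝ}
    (hE : E.Nonempty) (hval : gameVal (unifOn E) P = 1 - ε) (k₁ k₂ l m : ℕ)
    (hX : k₁ * l ≤ Fintype.card X) (hlX : l ≤ Fintype.card X) (hlY : l ≤ Fintype.card Y) :
    glkVal E P (k₁ + k₂) l ^ (m + 1) ≤
      Real.exp (-(k₁ * (l / Fintype.card X) * (E.card / maxDeg E) *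
        (ε - 2 * ((1 - (l : ℝ) / Fintype.card Y) ^ k₂) ^ (m + 1)))) := by
  obtain ⟨φ, -, hφ⟩ := exists_mem_eq_sup' (s := (univ : Finset
    (SubPairs X Y l → (X → AX) × (Y → AY)))) ⟨fun _ => (fun _ => Classical.arbitrary AX,
      fun _ => Classical.arbitrary AY), mem_univ _⟩
    fun φ => ∑ S : Fin (k₁ + k₂) → SubPairs X Y l,
        ((Fintype.card (SubPairs X Y l) : ℝ) ^ (k₁ + k₂))⁻¹ *
          (if (∀ i j : Fin (k₁ + k₂), ∀ a : X, a ∈ (S i).1.1 → a ∈ (S j).1.1 →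
                  (φ (S i)).1 a = (φ (S j)).1 a) ∧
              (∀ i j : Fin (k₁ + k₂), ∀ b : Y, b ∈ (S i).1.2 → b ∈ (S j).1.2 →
                  (φ (S i)).2 b = (φ (S j)).2 b) ∧
              (∀ i j : Fin (k₁ + k₂), ∀ a ∈ (S i).1.1, ∀ b ∈ (S j).1.2, (a, b) ∈ E →
                  P a b ((φ (S i)).1 a) ((φ (S j)).2 b))
            then (1 : ℝ) else 0)
  have hglk : glkVal E P (k₁ + k₂) l = _ := hφ
  rw [hglk, ← mul_sum]
  have hN : 0 < Fintype.card (SubPairs X Y l) := by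
    rw [card_subPairs, card_powersetCard, card_powersetCard, card_univ, card_univ]
    exact Nat.mul_pos (Nat.choose_pos hlX) (Nat.choose_pos hlY)
  have : Nonempty (SubPairs X Y l) := Fintype.card_pos_iff.1 hN
  have hmain := sum_win_pow_le hE hval (fun v : SubPairs X Y l => v.1.1) (fun v => v.1.2)
    (fun v => (φ v).1) (fun v => (φ v).2) (η := (l : ℝ) / Fintype.card X)
    (q := 1 - (l : ℝ) / Fintype.card Y) (by positivity)
    (sub_nonneg.2 (div_le_one_of_le₀ (by exact_mod_cast hlY) (Nat.cast_nonneg _))) k₁ k₂ m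
    (by
      rw [← mul_div_assoc]
      exact div_le_one_of_le₀ (by exact_mod_cast hX) (Nat.cast_nonneg _))
    (fun A => by convert card_subPairs_disjoint_fst_le hlX A)
    (fun A => by convert card_subPairs_disjoint_snd_le hlY A)
  have hNpow : (0 : ℝ) < ((Fintype.card (SubPairs X Y l) : ℝ) ^ (k₁ + k₂)) ^ (m + 1) := by
    positivity
  rw [mul_pow, inv_pow, inv_mul_le_iff₀ hNpow]
  refine le_trans (pow_le_pow_left₀ (sum_nonneg fun S _ => by split_ifs <;> norm_num) ?_ _) hmain
  rw [← (Fin.appendEquiv k₁ k₂).sum_comp, Fintype.sum_prod_type]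
  refine sum_le_sum fun a _ => sum_le_sum fun c _ => ?_
  split_ifs with h1 h2 h2
  · exact le_rfl
  · refine absurd (fun i j x hx y hy hxy => ?_) h2
    simpa [Fin.appendEquiv] using h1.2.2 (Fin.castAdd k₂ i) (Fin.natAdd k₁ j) x
      (by simpa [Fin.appendEquiv] using hx) y (by simpa [Fin.appendEquiv] using hy) hxy
  · exact zero_le_one
  · exact le_rfl

lemma glkVal_nonneg (E : Finset (X × Y)) (P : X → Y → AX → AY → Prop) (k l : ℕ) :
    0 ≤ glkVal E P k l :=
  le_sup'_of_le _ (mem_univ fun _ => (fun _ => Classical.arbitrary AX,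
    fun _ => Classical.arbitrary AY)) (sum_nonneg fun S _ => by positivity)

/-- A bound on the value of `G^l_k` that does not need the projection property. -/
lemma glkVal_le_exp {E : Finset (X × Y)} {P : X → Y → AX → AY → Prop} {ε : ℝ}
    (hE : E.Nonempty) (hval : gameVal (unifOn E) P = 1 - ε) (hε : 0 < ε) {k l : ℕ} (hk : 2 ≤ k)
    (hl : 0 < l) (hX : k * l ≤ Fintype.card X) (hY : k * l ≤ Fintype.card Y) :
    glkVal E P k l ≤ Real.exp (-((k : ℝ) ^ 2 * (l : ℝ) ^ 2 * (E.card / maxDeg E) * ε ^ 2 /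
      (96 * Fintype.card X * Fintype.card Y))) := by
  have hε1 := (gap_mem_Icc hE hval).2
  obtain ⟨k₁, k₂, rfl, h₁, h₂⟩ : ∃ k₁ k₂, k = k₁ + k₂ ∧ k ≤ 3 * k₁ ∧ k ≤ 2 * k₂ :=
    ⟨k / 2, k - k / 2, by omega, by omega, by omega⟩
  have hlX : l ≤ Fintype.card X := (Nat.le_mul_of_pos_left l (by omega)).trans hX
  have hlY : l ≤ Fintype.card Y := (Nat.le_mul_of_pos_left l (by omega)).trans hY
  have hk₂l : k₂ * l ≤ Fintype.card Y := (Nat.mul_le_mul_right l (by omega)).trans hY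
  have hk₁l : k₁ * l ≤ Fintype.card X := (Nat.mul_le_mul_right l (by omega)).trans hX
  set nX : ℝ := (Fintype.card X : ℝ) with hnX
  set nY : ℝ := (Fintype.card Y : ℝ) with hnY
  set R : ℝ := (E.card : ℝ) / maxDeg E with hR
  have hR0 : 0 ≤ R := by positivity
  have hl0 : (0 : ℝ) < l := by exact_mod_cast hl
  have hk₂0 : (0 : ℝ) < k₂ := by exact_mod_cast (by omega : 0 < k₂)
  have hnX0 : 0 < nX := by rw [hnX]; exact_mod_cast hl.trans_le hlX
  have hnY0 : 0 < nY := by rw [hnY]; exact_mod_cast hl.trans_le hlY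
  have hk₂lY : (k₂ : ℝ) * l ≤ nY := by rw [hnY]; exact_mod_cast hk₂l
  set t : ℝ := 4 * nY / (k₂ * l * ε) with ht
  have ht1 : 1 ≤ t := by
    rw [ht, one_le_div (by positivity)]
    nlinarith [mul_pos hk₂0 hl0]
  set m := ⌊t⌋₊ with hm
  have hm1 : t ≤ (m : ℝ) + 1 := (Nat.lt_floor_add_one t).le
  have hm2 : (m : ℝ) + 1 ≤ 2 * t := by linarith [Nat.floor_le (zero_le_one.trans ht1)]
  have hδ : ((1 - (l : ℝ) / nY) ^ k₂) ^ (m + 1) ≤ ε / 4 := by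
    have hq : 0 ≤ 1 - (l : ℝ) / nY :=
      sub_nonneg.2 (div_le_one_of_le₀ (by rw [hnY]; exact_mod_cast hlY) hnY0.le)
    calc ((1 - (l : ℝ) / nY) ^ k₂) ^ (m + 1)
        ≤ (Real.exp (-(l / nY)) ^ k₂) ^ (m + 1) := by
          gcongr
          exact Real.one_sub_le_exp_neg _
      _ = Real.exp (-((k₂ * l / nY) * (m + 1))) := by
          rw [← Real.exp_nat_mul, ← Real.exp_nat_mul]
          push_cast
          ring_nf
      _ ≤ Real.exp (-(4 / ε)) := by
          have : 4 / ε = (k₂ * l / nY) * t := by rw [ht]; field_simp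
          rw [this]
          gcongr
      _ ≤ (4 / ε)⁻¹ := by
          rw [Real.exp_neg]
          exact inv_anti₀ (by positivity) (by linarith [Real.add_one_le_exp (4 / ε)])
      _ = ε / 4 := inv_div _ _
  refine (pow_le_pow_iff_left₀ (glkVal_nonneg E P _ l) (Real.exp_pos _).le
    (Nat.succ_ne_zero m)).1 ((glkVal_pow_le hE hval k₁ k₂ l m hk₁l hlX hlY).trans ?_)
  rw [← Real.exp_nat_mul]
  refine Real.exp_le_exp.2 ?_
  have hkk : ((k₁ + k₂ : ℕ) : ℝ) ^ 2 ≤ 6 * (k₁ * k₂) := by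
    have h := Nat.mul_le_mul h₁ h₂
    have h' : (k₁ + k₂) ^ 2 ≤ 6 * (k₁ * k₂) := by nlinarith
    exact_mod_cast h'
  have hlhs : k₁ * (l / nX) * R * (ε / 2) ≤
      k₁ * (l / nX) * R * (ε - 2 * ((1 - (l : ℝ) / nY) ^ k₂) ^ (m + 1)) := by
    gcongr
    linarith
  have hrhs : ((m + 1 : ℕ) : ℝ) * (((k₁ + k₂ : ℕ) : ℝ) ^ 2 * (l : ℝ) ^ 2 * R * ε ^ 2 /
      (96 * nX * nY)) ≤ k₁ * (l / nX) * R * (ε / 2) := by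
    calc _ ≤ 2 * t * (6 * (k₁ * k₂) * (l : ℝ) ^ 2 * R * ε ^ 2 / (96 * nX * nY)) := by
          push_cast at hkk ⊢
          gcongr
      _ = _ := by
          rw [ht]
          field_simp
          norm_num
          ring
  linarith

end Game

lemma exp_neg_le_one_sub_half_s8 {ε : ℝ} (h0 : 0 ≤ ε) (h1 : ε ≤ 1) :
    Real.exp (-ε) ≤ 1 - ε / 2 := by
  rw [Real.exp_neg, inv_le_iff_one_le_mul₀ (Real.exp_pos _)]
  nlinarith [Real.add_one_le_exp ε]

universe u₁ u₂ u₃ u₄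

/-- **Value of `G^l_k` for projection games.**  There is a universal constant `γ > 0` such
that for any projection game `G` with question distribution uniform over `E`, maximum
degree `d_max` and `val(G) = 1 − ε`, for all `k ≥ 2` and `l ≥ 0` with `k·l ≤ |X|, |Y|`,
`val(G^l_k) ≤ 2·(1 − ε/2)^{γ·ε³·k²·l²·|E|/(d_max·|X|·|Y|)}`. -/
theorem glk_value_bound :
    ∃ γ : ℝ, 0 < γ ∧
      ∀ (X : Type u₁) (Y : Type u₂) (AX : Type u₃) (AY : Type u₄)
        [Fintype X] [Fintype Y] [Fintype AX] [Fintype AY] [Nonempty AX] [Nonempty AY]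
        (E : Finset (X × Y)) (P : X → Y → AX → AY → Prop) (ε : ℝ),
        E.Nonempty →
        (∀ x y, (x, y) ∈ E → ∃ f : AX → AY, ∀ a b, P x y a b ↔ f a = b) →
        gameVal (unifOn E) P = 1 - ε →
        ∀ k l : ℕ, 2 ≤ k → k * l ≤ Fintype.card X → k * l ≤ Fintype.card Y →
          glkVal E P k l ≤
            2 * (1 - ε / 2) ^
              (γ * ε ^ 3 * (k : ℝ) ^ 2 * (l : ℝ) ^ 2 * (E.card : ℝ) /
                ((maxDeg E : ℝ) * (Fintype.card X : ℝ) * (Fintype.card Y : ℝ))) := by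
  refine ⟨1 / 96, by norm_num, ?_⟩
  intro X Y AX AY _ _ _ _ _ _ E P ε hE _ hval k l hk hX hY
  obtain ⟨hε0, hε1⟩ := gap_mem_Icc hE hval
  rcases hε0.eq_or_lt with rfl | hε
  · exact (glkVal_le_one E P k l).trans (by norm_num)
  rcases Nat.eq_zero_or_pos l with rfl | hl
  · exact (glkVal_le_one E P k 0).trans (by norm_num)
  set a : ℝ := (k : ℝ) ^ 2 * (l : ℝ) ^ 2 * (E.card / maxDeg E) * ε ^ 2 /
    (96 * Fintype.card X * Fintype.card Y) with ha
  have ha0 : 0 ≤ a := by positivity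
  have hexp : 1 / 96 * ε ^ 3 * (k : ℝ) ^ 2 * (l : ℝ) ^ 2 * (E.card : ℝ) /
      ((maxDeg E : ℝ) * (Fintype.card X : ℝ) * (Fintype.card Y : ℝ)) = ε * a := by
    rw [ha]
    ring
  rw [hexp]
  calc glkVal E P k l ≤ Real.exp (-a) := glkVal_le_exp hE hval hε hk hl hX hY
    _ ≤ Real.exp (-ε * (ε * a)) := by
        gcongr
        nlinarith [mul_nonneg (sub_nonneg.2 hε1) ha0,
          mul_nonneg hε0 (mul_nonneg (sub_nonneg.2 hε1) ha0)]
    _ = Real.exp (-ε) ^ (ε * a) := Real.exp_mul _ _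
    _ ≤ (1 - ε / 2) ^ (ε * a) :=
        Real.rpow_le_rpow (Real.exp_pos _).le (exp_neg_le_one_sub_half_s8 hε0 hε1) (by positivity)
    _ ≤ 2 * (1 - ε / 2) ^ (ε * a) :=
        le_mul_of_one_le_left (Real.rpow_nonneg (by linarith) _) (by norm_num)
end
end

section
/- Let μ = {X_S} be an r-level Sherali–Adams solution of a Δ-dense Max k-CSP instance G = (V, W, {P_S}) with alphabet size q. Then for any integer l with 0 < l ≤ r − k, there exists an integer t ≤ l such that E_{T∼V^t}[ E_{φ_T∼X_T}[ C(μ|φ_T) ] ] ≤ k^2·log q / (l·Δ), where T is a uniformly random t-tuple of variables, φ_T is sampled from the marginal distribution X_T of the solution on the set of variables of T, and C(μ|φ_T) = E_{S∼W}[C_{μ|φ_T}(x_S)]. -/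
open Finset

attribute [local instance] Classical.propDecidable

noncomputable section

/-- Kullback–Leibler divergence between two distributions on a finite set, with the usual
convention that terms with `X θ = 0` contribute `0`. -/
def klDiv {Θ : Type*} [Fintype Θ] (X Y : Θ → ℝ) : ℝ :=
  ∑ θ : Θ, if X θ ≠ 0 then X θ * Real.log (X θ / Y θ) else 0

/-- The marginal probability, under `μ F`, of agreeing with `ψ` on `F`. -/
def marg {V A : Type*} [Fintype V] [Fintype A] (μ : Finset V → (V → A) → ℝ)
    (F : Finset V) (ψ : V → A) : ℝ :=
  ∑ φ : V → A, if ∀ a ∈ F, φ a = ψ a then μ F φ else 0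

/-- A family of distributions over full assignments whose marginals are consistent on the sets of
size at most `r`. -/
structure IsSheraliAdams {V A : Type*} [Fintype V] [Fintype A] (r : ℕ)
    (μ : Finset V → (V → A) → ℝ) : Prop where
  nonneg : ∀ S φ, 0 ≤ μ S φ
  sum_eq_one : ∀ S : Finset V, S.card ≤ r → ∑ φ : V → A, μ S φ = 1
  consistent : ∀ S T : Finset V, S.card ≤ r → T.card ≤ r → ∀ ψ : V → A,
      (∑ φ : V → A, if ∀ a ∈ S ∩ T, φ a = ψ a then μ S φ else 0) =
        (∑ φ : V → A, if ∀ a ∈ S ∩ T, φ a = ψ a then μ T φ else 0)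

/-- The Shannon entropy of the marginal of `μ F` on the variables of `F`. -/
def saEntropy {V A : Type*} [Fintype V] [Fintype A] (μ : Finset V → (V → A) → ℝ)
    (F : Finset V) : ℝ :=
  -∑ φ : V → A, μ F φ * Real.log (marg μ F φ)

/-- The law of `Z` under `μ G` conditioned on agreeing with `ψ` on `T`. -/
def condLaw {V A β : Type*} [Fintype V] [Fintype A] (μ : Finset V → (V → A) → ℝ)
    (T G : Finset V) (Z : (V → A) → β) (ψ : V → A) (b : β) : ℝ :=
  (∑ φ : V → A, if Z φ = b ∧ ∀ a ∈ T, φ a = ψ a then μ G φ else 0) / marg μ T ψ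

/-- The total correlation of the tuple `S` conditioned on the variables of `T`. -/
def condTotalCorrelation {V A : Type*} [Fintype V] [Fintype A] {k : ℕ} (μ : Finset V → (V → A) → ℝ) (T : Finset V)
    (S : Fin k → V) : ℝ :=
  ∑ ψ : V → A, μ T ψ *
    klDiv (condLaw μ T (Finset.image S Finset.univ ∪ T) (fun φ i => φ (S i)) ψ)
      (fun v => ∏ i, condLaw μ T (insert (S i) T) (fun φ => φ (S i)) ψ (v i))

theorem klDiv_eq_sum {Θ : Type*} [Fintype Θ] (X Y : Θ → ℝ) :
    klDiv X Y = ∑ θ, X θ * Real.log (X θ / Y θ) := by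
  refine Finset.sum_congr rfl fun θ _ => ?_
  by_cases h : X θ = 0 <;> simp [h]

theorem klDiv_nonneg {Θ : Type*} [Fintype Θ] {X Y : Θ → ℝ} (hX : ∀ θ, 0 ≤ X θ)
    (hY : ∀ θ, 0 ≤ Y θ) (hXY : ∀ θ, X θ ≠ 0 → Y θ ≠ 0) (hsum : ∑ θ, Y θ ≤ ∑ θ, X θ) :
    0 ≤ klDiv X Y := by
  have key : ∑ θ, (X θ - Y θ) ≤ klDiv X Y := by
    rw [klDiv_eq_sum]
    refine Finset.sum_le_sum fun θ _ => ?_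
    by_cases h : X θ = 0
    · simp [h, hY θ]
    have hx : 0 < X θ := lt_of_le_of_ne (hX θ) (Ne.symm h)
    have hy : 0 < Y θ := lt_of_le_of_ne (hY θ) (Ne.symm (hXY θ h))
    have h1 := Real.one_sub_inv_le_log_of_pos (div_pos hx hy)
    calc X θ - Y θ = X θ * (1 - (X θ / Y θ)⁻¹) := by field_simp
      _ ≤ _ := mul_le_mul_of_nonneg_left h1 hx.le
  rw [Finset.sum_sub_distrib] at key
  linarith

theorem insert_subset_image_union {V : Type*} {k : ℕ} (T : Finset V) (S : Fin k → V) (i : Fin k) :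
    insert (S i) T ⊆ Finset.image S Finset.univ ∪ T :=
  Finset.insert_subset (Finset.mem_union_left _ (Finset.mem_image_of_mem _ (Finset.mem_univ i)))
    Finset.subset_union_right

section Marginals

variable {V A : Type*} [Fintype V] [Fintype A] {r : ℕ} {μ : Finset V → (V → A) → ℝ}

theorem marg_congr (μ : Finset V → (V → A) → ℝ) {F : Finset V} {φ ψ : V → A}
    (h : ∀ a ∈ F, φ a = ψ a) : marg μ F φ = marg μ F ψ := by
  refine Finset.sum_congr rfl fun χ _ => ?_
  have : (∀ a ∈ F, χ a = φ a) ↔ ∀ a ∈ F, χ a = ψ a :=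
    ⟨fun H a ha => (H a ha).trans (h a ha), fun H a ha => (H a ha).trans (h a ha).symm⟩
  simp only [this]

theorem condLaw_congr {β : Type*} (μ : Finset V → (V → A) → ℝ) {T : Finset V} (G : Finset V)
    (Z : (V → A) → β) {φ ψ : V → A} (h : ∀ a ∈ T, φ a = ψ a) (b : β) :
    condLaw μ T G Z φ b = condLaw μ T G Z ψ b := by
  unfold condLaw
  rw [marg_congr μ h]
  congr 1
  refine Finset.sum_congr rfl fun χ _ => ?_
  have : (∀ a ∈ T, χ a = φ a) ↔ ∀ a ∈ T, χ a = ψ a :=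
    ⟨fun H a ha => (H a ha).trans (h a ha), fun H a ha => (H a ha).trans (h a ha).symm⟩
  simp only [this]

namespace IsSheraliAdams

theorem marg_nonneg (hμ : IsSheraliAdams r μ) (F : Finset V) (ψ : V → A) : 0 ≤ marg μ F ψ :=
  Finset.sum_nonneg fun φ _ => by split_ifs <;> simp [hμ.nonneg]

theorem marg_eq (hμ : IsSheraliAdams r μ) {F G : Finset V} (hFG : F ⊆ G) (hG : G.card ≤ r)
    (ψ : V → A) :
    (∑ φ : V → A, if ∀ a ∈ F, φ a = ψ a then μ G φ else 0) = marg μ F ψ := by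
  have h := hμ.consistent G F hG ((Finset.card_le_card hFG).trans hG) ψ
  rwa [Finset.inter_eq_right.2 hFG] at h

theorem le_marg (hμ : IsSheraliAdams r μ) {F G : Finset V} (hFG : F ⊆ G) (hG : G.card ≤ r)
    (ψ : V → A) : μ G ψ ≤ marg μ F ψ := by
  rw [← hμ.marg_eq hFG hG]
  have := Finset.single_le_sum
    (f := fun φ : V → A => if ∀ a ∈ F, φ a = ψ a then μ G φ else 0)
    (fun φ _ => by split_ifs <;> simp [hμ.nonneg]) (Finset.mem_univ ψ)
  simpa using this

theorem marg_anti (hμ : IsSheraliAdams r μ) {F G : Finset V} (hFG : F ⊆ G) (hG : G.card ≤ r)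
    (ψ : V → A) : marg μ G ψ ≤ marg μ F ψ := by
  rw [← hμ.marg_eq hFG hG]
  refine Finset.sum_le_sum fun φ _ => ?_
  by_cases h : ∀ a ∈ G, φ a = ψ a
  · rw [if_pos h, if_pos fun a ha => h a (hFG ha)]
  · rw [if_neg h]
    split_ifs <;> simp [hμ.nonneg]

/-- The tower property for conditioning on the variables of `F`. -/
theorem sum_condExp (hμ : IsSheraliAdams r μ) {F G : Finset V} (hFG : F ⊆ G) (hG : G.card ≤ r)
    (f : (V → A) → ℝ) :
    ∑ ψ : V → A, μ F ψ *
        ((∑ φ : V → A, if ∀ a ∈ F, φ a = ψ a then μ G φ * f φ else 0) / marg μ F ψ) =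
      ∑ φ : V → A, μ G φ * f φ := by
  have h1 : ∀ ψ : V → A, μ F ψ *
        ((∑ φ : V → A, if ∀ a ∈ F, φ a = ψ a then μ G φ * f φ else 0) / marg μ F ψ) =
      ∑ φ : V → A, μ G φ * f φ / marg μ F φ * (if ∀ a ∈ F, ψ a = φ a then μ F ψ else 0) := by
    intro ψ
    rw [Finset.sum_div, Finset.mul_sum]
    refine Finset.sum_congr rfl fun φ _ => ?_
    by_cases h : ∀ a ∈ F, φ a = ψ a
    · rw [if_pos h, if_pos fun a ha => (h a ha).symm, marg_congr μ h]
      ring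
    · rw [if_neg h, if_neg fun H => h fun a ha => (H a ha).symm]
      simp
  rw [Finset.sum_congr rfl fun ψ _ => h1 ψ, Finset.sum_comm]
  refine Finset.sum_congr rfl fun φ _ => ?_
  rw [← Finset.mul_sum]
  change _ * marg μ F φ = _
  by_cases h : marg μ F φ = 0
  · have h2 : μ G φ = 0 := le_antisymm (h ▸ hμ.le_marg hFG hG φ) (hμ.nonneg G φ)
    simp [h2]
  · field_simp

theorem sum_eq_of_local (hμ : IsSheraliAdams r μ) {F G : Finset V} (hFG : F ⊆ G)
    (hG : G.card ≤ r) {f : (V → A) → ℝ} (hf : ∀ φ ψ, (∀ a ∈ F, φ a = ψ a) → f φ = f ψ) :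
    ∑ φ : V → A, μ G φ * f φ = ∑ φ : V → A, μ F φ * f φ := by
  rw [← hμ.sum_condExp hFG hG]
  refine Finset.sum_congr rfl fun ψ _ => ?_
  have h1 : (∑ φ : V → A, if ∀ a ∈ F, φ a = ψ a then μ G φ * f φ else 0) =
      marg μ F ψ * f ψ := by
    rw [← hμ.marg_eq hFG hG, Finset.sum_mul]
    refine Finset.sum_congr rfl fun φ _ => ?_
    split_ifs with h
    · rw [hf φ ψ h]
    · simp
  rw [h1]
  by_cases h : marg μ F ψ = 0
  · have h2 : μ F ψ = 0 :=
      le_antisymm (h ▸ hμ.le_marg subset_rfl ((Finset.card_le_card hFG).trans hG) ψ)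
        (hμ.nonneg F ψ)
    simp [h2]
  · field_simp

theorem sum_mul_log_marg (hμ : IsSheraliAdams r μ) {F G : Finset V} (hFG : F ⊆ G)
    (hG : G.card ≤ r) :
    ∑ φ : V → A, μ G φ * Real.log (marg μ F φ) = -saEntropy μ F := by
  rw [saEntropy, neg_neg]
  exact hμ.sum_eq_of_local hFG hG fun φ ψ h => by rw [marg_congr μ h]

theorem saEntropy_mono (hμ : IsSheraliAdams r μ) {F G : Finset V} (hFG : F ⊆ G)
    (hG : G.card ≤ r) : saEntropy μ F ≤ saEntropy μ G := by
  rw [← neg_le_neg_iff, ← hμ.sum_mul_log_marg subset_rfl hG, ← hμ.sum_mul_log_marg hFG hG]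
  refine Finset.sum_le_sum fun φ _ => ?_
  rcases (hμ.nonneg G φ).eq_or_lt with h | h
  · simp [← h]
  · exact mul_le_mul_of_nonneg_left (Real.log_le_log
      (h.trans_le (hμ.le_marg subset_rfl hG φ)) (hμ.marg_anti hFG hG φ)) h.le

theorem condLaw_nonneg {β : Type*} (hμ : IsSheraliAdams r μ) (T G : Finset V)
    (Z : (V → A) → β) (ψ : V → A) (b : β) : 0 ≤ condLaw μ T G Z ψ b :=
  div_nonneg (Finset.sum_nonneg fun φ _ => by split_ifs <;> simp [hμ.nonneg])
    (hμ.marg_nonneg T ψ)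

theorem sum_condLaw_mul {β : Type*} [Fintype β] (T G : Finset V)
    (Z : (V → A) → β) (ψ : V → A) (L : β → ℝ) :
    ∑ b, condLaw μ T G Z ψ b * L b =
      (∑ φ : V → A, if ∀ a ∈ T, φ a = ψ a then μ G φ * L (Z φ) else 0) / marg μ T ψ := by
  simp only [condLaw, div_mul_eq_mul_div, Finset.sum_mul]
  rw [← Finset.sum_div, Finset.sum_comm]
  congr 1
  refine Finset.sum_congr rfl fun φ _ => ?_
  by_cases h : ∀ a ∈ T, φ a = ψ a
  · simp only [and_iff_left h, if_pos h, ite_mul, zero_mul]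
    rw [Finset.sum_ite_eq, if_pos (Finset.mem_univ _)]
  · simp only [h, and_false, if_false, zero_mul, Finset.sum_const_zero]

theorem sum_condLaw {β : Type*} [Fintype β] (hμ : IsSheraliAdams r μ) {T G : Finset V}
    (hTG : T ⊆ G) (hG : G.card ≤ r) (Z : (V → A) → β) {ψ : V → A} (hψ : marg μ T ψ ≠ 0) :
    ∑ b, condLaw μ T G Z ψ b = 1 := by
  have h := sum_condLaw_mul (μ := μ) T G Z ψ fun _ => 1
  simp only [mul_one] at h
  rw [h, hμ.marg_eq hTG hG, div_self hψ]

theorem condLaw_apply {β : Type*} {T G : Finset V} {Z : (V → A) → β}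
    (hZ : ∀ φ χ : V → A, (Z χ = Z φ ∧ ∀ a ∈ T, χ a = φ a) ↔ ∀ a ∈ G, χ a = φ a) (φ : V → A) :
    condLaw μ T G Z φ (Z φ) = marg μ G φ / marg μ T φ := by
  unfold condLaw
  congr 1
  refine Finset.sum_congr rfl fun χ _ => ?_
  simp only [hZ]

theorem sum_mul_klDiv_condLaw {β : Type*} [Fintype β] (hμ : IsSheraliAdams r μ)
    {T G : Finset V} (hTG : T ⊆ G) (hG : G.card ≤ r) {Z : (V → A) → β}
    (hZ : ∀ φ χ : V → A, (Z χ = Z φ ∧ ∀ a ∈ T, χ a = φ a) ↔ ∀ a ∈ G, χ a = φ a)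
    {Y : (V → A) → β → ℝ} (hY : ∀ φ ψ, (∀ a ∈ T, φ a = ψ a) → Y φ = Y ψ) :
    ∑ ψ : V → A, μ T ψ * klDiv (condLaw μ T G Z ψ) (Y ψ) =
      ∑ φ : V → A, μ G φ * Real.log (marg μ G φ / marg μ T φ / Y φ (Z φ)) := by
  rw [← hμ.sum_condExp hTG hG]
  refine Finset.sum_congr rfl fun ψ _ => ?_
  rw [klDiv_eq_sum, sum_condLaw_mul T G Z ψ fun b => Real.log (condLaw μ T G Z ψ b / Y ψ b)]
  congr 2
  refine Finset.sum_congr rfl fun φ _ => ?_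
  split_ifs with h
  · rw [← condLaw_congr μ G Z h, ← hY φ ψ h, condLaw_apply hZ]
  · rfl

/-- The chain rule: revealing one more variable adds at most `log |A|` to the entropy. -/
theorem saEntropy_insert_le (hμ : IsSheraliAdams r μ) (x : V) {T : Finset V}
    (hG : (insert x T).card ≤ r) :
    saEntropy μ (insert x T) ≤ saEntropy μ T + Real.log (Fintype.card A) := by
  have hTG : T ⊆ insert x T := Finset.subset_insert x T
  have hT := (Finset.card_le_card hTG).trans hG
  have hZ : ∀ φ χ : V → A, (χ x = φ x ∧ ∀ a ∈ T, χ a = φ a) ↔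
      ∀ a ∈ insert x T, χ a = φ a := fun φ χ => by simp
  have hne : Nonempty (V → A) := by
    by_contra hc
    rw [not_nonempty_iff] at hc
    simpa using hμ.sum_eq_one T hT
  have hA : (0 : ℝ) < Fintype.card A := by
    have : Nonempty A := ⟨hne.some x⟩
    exact_mod_cast Fintype.card_pos
  have key := hμ.sum_mul_klDiv_condLaw hTG hG (Z := fun φ => φ x) hZ
    (Y := fun _ _ => (Fintype.card A : ℝ)⁻¹) (fun _ _ _ => rfl)
  have hpos : 0 ≤ ∑ ψ : V → A, μ T ψ *
      klDiv (condLaw μ T (insert x T) (fun φ => φ x) ψ) (fun _ => (Fintype.card A : ℝ)⁻¹) := by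
    refine Finset.sum_nonneg fun ψ _ => ?_
    rcases (hμ.nonneg T ψ).eq_or_lt with h | h
    · simp [← h]
    refine mul_nonneg h.le (klDiv_nonneg (hμ.condLaw_nonneg _ _ _ _) (fun _ => by positivity)
      (fun _ _ => by positivity) ?_)
    rw [hμ.sum_condLaw hTG hG _ (h.trans_le (hμ.le_marg subset_rfl hT ψ)).ne']
    simp [hA.ne']
  have hlog : ∀ φ : V → A, μ (insert x T) φ * Real.log
      (marg μ (insert x T) φ / marg μ T φ / (Fintype.card A : ℝ)⁻¹) =
      μ (insert x T) φ * Real.log (marg μ (insert x T) φ) -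
        μ (insert x T) φ * Real.log (marg μ T φ) +
        μ (insert x T) φ * Real.log (Fintype.card A) := by
    intro φ
    rcases (hμ.nonneg (insert x T) φ).eq_or_lt with h | h
    · simp [← h]
    have h1 := h.trans_le (hμ.le_marg hTG hG φ)
    have h2 := h.trans_le (hμ.le_marg subset_rfl hG φ)
    rw [Real.log_div (by positivity) (by positivity), Real.log_div h2.ne' h1.ne', Real.log_inv]
    ring
  rw [key, Finset.sum_congr rfl fun φ _ => hlog φ, Finset.sum_add_distrib,
    Finset.sum_sub_distrib, hμ.sum_mul_log_marg subset_rfl hG, hμ.sum_mul_log_marg hTG hG,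
    ← Finset.sum_mul, hμ.sum_eq_one _ hG] at hpos
  linarith

theorem condTotalCorrelation_eq {k : ℕ} (hμ : IsSheraliAdams r μ) (T : Finset V)
    (S : Fin k → V) (hG : (Finset.image S Finset.univ ∪ T).card ≤ r) :
    condTotalCorrelation μ T S =
      ∑ i, (saEntropy μ (insert (S i) T) - saEntropy μ T) -
        (saEntropy μ (Finset.image S Finset.univ ∪ T) - saEntropy μ T) := by
  have hTG : T ⊆ Finset.image S Finset.univ ∪ T := Finset.subset_union_right
  have hiG := insert_subset_image_union T S
  have hZ : ∀ φ χ : V → A, ((fun i => χ (S i)) = (fun i => φ (S i)) ∧ ∀ a ∈ T, χ a = φ a) ↔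
      ∀ a ∈ Finset.image S Finset.univ ∪ T, χ a = φ a := by
    intro φ χ
    rw [Finset.forall_mem_union, funext_iff]
    simp
  have hZi : ∀ x, ∀ φ χ : V → A, (χ x = φ x ∧ ∀ a ∈ T, χ a = φ a) ↔
      ∀ a ∈ insert x T, χ a = φ a := fun x φ χ => by simp
  unfold condTotalCorrelation
  rw [hμ.sum_mul_klDiv_condLaw hTG hG hZ (Y := fun ψ v =>
    ∏ i, condLaw μ T (insert (S i) T) (fun φ => φ (S i)) ψ (v i))
    (fun φ ψ h => funext fun v => Finset.prod_congr rfl fun i _ => condLaw_congr μ _ _ h _)]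
  set G := Finset.image S Finset.univ ∪ T
  have hlog : ∀ φ : V → A, μ G φ * Real.log (marg μ G φ / marg μ T φ /
      ∏ i, condLaw μ T (insert (S i) T) (fun φ => φ (S i)) φ (φ (S i))) =
      μ G φ * Real.log (marg μ G φ) - μ G φ * Real.log (marg μ T φ) -
        ∑ i, (μ G φ * Real.log (marg μ (insert (S i) T) φ) -
          μ G φ * Real.log (marg μ T φ)) := by
    intro φ
    rcases (hμ.nonneg G φ).eq_or_lt with h | h
    · simp [← h]
    have h1 := h.trans_le (hμ.le_marg hTG hG φ)
    have h2 := h.trans_le (hμ.le_marg subset_rfl hG φ)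
    have h3 : ∀ i, 0 < marg μ (insert (S i) T) φ := fun i =>
      h.trans_le (hμ.le_marg (hiG i) hG φ)
    have h4 : ∀ i, condLaw μ T (insert (S i) T) (fun φ => φ (S i)) φ (φ (S i)) =
        marg μ (insert (S i) T) φ / marg μ T φ := fun i => condLaw_apply (hZi (S i)) φ
    simp only [h4]
    rw [Real.log_div (by positivity) (Finset.prod_ne_zero_iff.2 fun i _ =>
      (div_pos (h3 i) h1).ne'), Real.log_div h2.ne' h1.ne',
      Real.log_prod (fun i _ => (div_pos (h3 i) h1).ne'), mul_sub, mul_sub, Finset.mul_sum]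
    congr 1
    refine Finset.sum_congr rfl fun i _ => ?_
    rw [Real.log_div (h3 i).ne' h1.ne', mul_sub]
  rw [Finset.sum_congr rfl fun φ _ => hlog φ, Finset.sum_sub_distrib, Finset.sum_sub_distrib,
    Finset.sum_comm, hμ.sum_mul_log_marg subset_rfl hG, hμ.sum_mul_log_marg hTG hG]
  have h5 : ∀ i, ∑ φ : V → A, (μ G φ * Real.log (marg μ (insert (S i) T) φ) -
      μ G φ * Real.log (marg μ T φ)) = -(saEntropy μ (insert (S i) T) - saEntropy μ T) := by
    intro i
    rw [Finset.sum_sub_distrib, hμ.sum_mul_log_marg (hiG i) hG, hμ.sum_mul_log_marg hTG hG]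
    ring
  rw [Finset.sum_congr rfl fun i _ => h5 i, Finset.sum_neg_distrib]
  ring

theorem condTotalCorrelation_nonneg {k : ℕ} (hμ : IsSheraliAdams r μ) (T : Finset V)
    (S : Fin k → V) (hG : (Finset.image S Finset.univ ∪ T).card ≤ r) :
    0 ≤ condTotalCorrelation μ T S := by
  have hTG : T ⊆ Finset.image S Finset.univ ∪ T := Finset.subset_union_right
  have hiG := insert_subset_image_union T S
  have hi : ∀ i, (insert (S i) T).card ≤ r := fun i => (Finset.card_le_card (hiG i)).trans hG
  have hT := (Finset.card_le_card hTG).trans hG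
  refine Finset.sum_nonneg fun ψ _ => ?_
  rcases (hμ.nonneg T ψ).eq_or_lt with h | h
  · simp [← h]
  have hψ := h.trans_le (hμ.le_marg subset_rfl hT ψ)
  refine mul_nonneg h.le (klDiv_nonneg (hμ.condLaw_nonneg _ _ _ _)
    (fun v => Finset.prod_nonneg fun i _ => hμ.condLaw_nonneg _ _ _ _ _) ?_ ?_)
  · intro v hv
    obtain ⟨φ, -, hφ⟩ := Finset.exists_ne_zero_of_sum_ne_zero (div_ne_zero_iff.1 hv).1
    split_ifs at hφ with hc
    swap
    · exact absurd rfl hφ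
    obtain ⟨rfl, hφT⟩ := hc
    refine Finset.prod_ne_zero_iff.2 fun i _ => ?_
    rw [← condLaw_congr μ _ _ hφT, condLaw_apply (Z := fun φ : V → A => φ (S i))
      (fun φ χ => by simp), marg_congr μ hφT]
    have hpos := lt_of_le_of_ne (hμ.nonneg _ φ) (Ne.symm hφ)
    exact div_ne_zero (hpos.trans_le (hμ.le_marg (hiG i) hG φ)).ne' hψ.ne'
  · rw [hμ.sum_condLaw hTG hG _ hψ.ne', ← Fintype.piFinset_univ, ← Finset.prod_univ_sum]
    exact (Finset.prod_eq_one fun i _ =>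
      hμ.sum_condLaw (Finset.subset_insert _ _) (hi i) _ hψ.ne').le

end IsSheraliAdams

end Marginals

section Averages

theorem card_image_union_image_le {V : Type*} {t k : ℕ} (T : Fin t → V) (S : Fin k → V) :
    (Finset.image S Finset.univ ∪ Finset.image T Finset.univ).card ≤ t + k := by
  have h1 := Finset.card_union_le (Finset.image S Finset.univ) (Finset.image T Finset.univ)
  have h2 : (Finset.image S Finset.univ).card ≤ k := by
    simpa using Finset.card_image_le (s := Finset.univ) (f := S)
  have h3 : (Finset.image T Finset.univ).card ≤ t := by
    simpa using Finset.card_image_le (s := Finset.univ) (f := T)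
  omega

theorem card_insert_image_le {V : Type*} {t : ℕ} (T : Fin t → V) (x : V) :
    (insert x (Finset.image T Finset.univ)).card ≤ t + 1 := by
  have h3 : (Finset.image T Finset.univ).card ≤ t := by
    simpa using Finset.card_image_le (s := Finset.univ) (f := T)
  exact (Finset.card_insert_le _ _).trans (by omega)

theorem sum_image_append {V : Type*} [Fintype V] (t k : ℕ) (f : Finset V → ℝ) :
    ∑ T : Fin t → V, ∑ S : Fin k → V,
        f (Finset.image S Finset.univ ∪ Finset.image T Finset.univ) =
      ∑ U : Fin (t + k) → V, f (Finset.image U Finset.univ) := by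
  rw [← Fintype.sum_prod_type', ← (Fin.appendEquiv t k).sum_comp]
  refine Finset.sum_congr rfl fun p _ => congrArg f ?_
  ext x
  simp only [Finset.mem_union, Finset.mem_image, Finset.mem_univ, true_and, Fin.appendEquiv,
    Equiv.coe_fn_mk]
  constructor
  · rintro (⟨i, rfl⟩ | ⟨i, rfl⟩)
    exacts [⟨Fin.natAdd t i, by simp⟩, ⟨Fin.castAdd k i, by simp⟩]
  · rintro ⟨i, rfl⟩
    refine Fin.addCases (fun i => ?_) (fun i => ?_) i <;> simp

theorem average_apply {V : Type*} [Fintype V] (hn : Fintype.card V ≠ 0) {k : ℕ} (i : Fin k)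
    (f : V → ℝ) :
    ((Fintype.card V : ℝ) ^ k)⁻¹ * ∑ S : Fin k → V, f (S i) =
      (Fintype.card V : ℝ)⁻¹ * ∑ x, f x := by
  obtain ⟨k, rfl⟩ : ∃ m, k = m + 1 := ⟨k - 1, by have := i.2; omega⟩
  rw [← (Fin.insertNthEquiv (fun _ => V) i).sum_comp, Fintype.sum_prod_type]
  have : (Fintype.card V : ℝ) ≠ 0 := by exact_mod_cast hn
  simp [← Finset.mul_sum]
  field_simp
  ring

theorem sum_image_insert {V : Type*} [Fintype V] (t : ℕ) (f : Finset V → ℝ) :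
    ∑ T : Fin t → V, ∑ x, f (insert x (Finset.image T Finset.univ)) =
      ∑ U : Fin (t + 1) → V, f (Finset.image U Finset.univ) := by
  rw [← sum_image_append t 1 f]
  refine Finset.sum_congr rfl fun T _ => ?_
  rw [← (Equiv.funUnique (Fin 1) V).symm.sum_comp]
  refine Finset.sum_congr rfl fun x _ => congrArg f ?_
  ext y
  simp [eq_comm]

/-- Telescoping bound for the shifted increments of a sequence with increments in `[0, L]`. -/
theorem sum_sub_shift_le {h : ℕ → ℝ} {L : ℝ} {l k : ℕ} (h0 : ∀ t, t < l + k → 0 ≤ h t)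
    (hL : ∀ t, t < l + k → h t ≤ L) {i : ℕ} (hi : i ≤ k) :
    ∑ t ∈ Finset.range l, (h t - h (t + i)) ≤ i * L := by
  induction i with
  | zero => simp
  | succ i ih =>
    have h1 := ih (by omega)
    have h2 : ∑ t ∈ Finset.range l, (h t - h (t + (i + 1))) =
        ∑ t ∈ Finset.range l, (h t - h (t + i)) + (h i - h (l + i)) := by
      have h3 := Finset.sum_range_sub' (fun t => h (t + i)) l
      rw [zero_add] at h3
      rw [← h3, ← Finset.sum_add_distrib]
      refine Finset.sum_congr rfl fun t _ => ?_
      rw [show t + (i + 1) = t + 1 + i by ring]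
      ring
    have h4 := h0 (l + i) (by omega)
    have h5 := hL i (by omega)
    push_cast
    linarith

/-- The average entropy of the variables of a uniformly random `t`-tuple. -/
def avgEntropy {V A : Type*} [Fintype V] [Fintype A] (μ : Finset V → (V → A) → ℝ) (t : ℕ) : ℝ :=
  ((Fintype.card V : ℝ) ^ t)⁻¹ * ∑ T : Fin t → V, saEntropy μ (Finset.image T Finset.univ)

namespace IsSheraliAdams

variable {V A : Type*} [Fintype V] [Fintype A] {r : ℕ} {μ : Finset V → (V → A) → ℝ}

theorem average_condTotalCorrelation_eq (hμ : IsSheraliAdams r μ) (hn : Fintype.card V ≠ 0)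
    {k t : ℕ} (htk : t + k ≤ r) :
    ((Fintype.card V : ℝ) ^ t)⁻¹ * ∑ T : Fin t → V, ((Fintype.card V : ℝ) ^ k)⁻¹ *
        ∑ S : Fin k → V, condTotalCorrelation μ (Finset.image T Finset.univ) S =
      k * (avgEntropy μ (t + 1) - avgEntropy μ t) -
        (avgEntropy μ (t + k) - avgEntropy μ t) := by
  have hn' : (Fintype.card V : ℝ) ≠ 0 := by exact_mod_cast hn
  have hcard : ∀ (T : Fin t → V) (S : Fin k → V),
      (Finset.image S Finset.univ ∪ Finset.image T Finset.univ).card ≤ r :=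
    fun T S => (card_image_union_image_le T S).trans htk
  have hinner : ∀ T : Fin t → V, ((Fintype.card V : ℝ) ^ k)⁻¹ *
        ∑ S : Fin k → V, condTotalCorrelation μ (Finset.image T Finset.univ) S =
      k * ((Fintype.card V : ℝ)⁻¹ *
        ∑ x, saEntropy μ (insert x (Finset.image T Finset.univ))) -
      ((Fintype.card V : ℝ) ^ k)⁻¹ * (∑ S : Fin k → V,
        saEntropy μ (Finset.image S Finset.univ ∪ Finset.image T Finset.univ)) +
      (1 - k) * saEntropy μ (Finset.image T Finset.univ) := by
    intro T
    rw [Finset.sum_congr rfl fun S _ => hμ.condTotalCorrelation_eq _ S (hcard T S)]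
    simp only [Finset.sum_sub_distrib]
    rw [Finset.sum_comm]
    rw [mul_sub, mul_sub, mul_sub, Finset.mul_sum (Finset.univ : Finset (Fin k)),
      Finset.sum_congr rfl fun i _ => average_apply hn i fun x =>
      saEntropy μ (insert x (Finset.image T Finset.univ))]
    simp
    field_simp
    ring
  rw [Finset.sum_congr rfl fun T _ => hinner T, Finset.sum_add_distrib, Finset.sum_sub_distrib]
  simp only [← Finset.mul_sum]
  rw [sum_image_append, sum_image_insert]
  simp only [avgEntropy, pow_add, mul_inv, pow_one]
  ring

theorem avgEntropy_succ_sub (hn : Fintype.card V ≠ 0) (t : ℕ) :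
    avgEntropy μ (t + 1) - avgEntropy μ t =
      ((Fintype.card V : ℝ) ^ (t + 1))⁻¹ * ∑ T : Fin t → V, ∑ x,
        (saEntropy μ (insert x (Finset.image T Finset.univ)) -
          saEntropy μ (Finset.image T Finset.univ)) := by
  have hn' : (Fintype.card V : ℝ) ≠ 0 := by exact_mod_cast hn
  simp only [Finset.sum_sub_distrib]
  rw [sum_image_insert]
  simp only [avgEntropy, Finset.sum_const, Finset.card_univ, nsmul_eq_mul, ← Finset.mul_sum]
  field_simp
  ring

theorem avgEntropy_succ_sub_nonneg (hμ : IsSheraliAdams r μ) (hn : Fintype.card V ≠ 0) {t : ℕ}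
    (ht : t < r) : 0 ≤ avgEntropy μ (t + 1) - avgEntropy μ t := by
  rw [avgEntropy_succ_sub hn]
  refine mul_nonneg (by positivity) (Finset.sum_nonneg fun T _ => Finset.sum_nonneg fun x _ =>
    sub_nonneg.2 (hμ.saEntropy_mono (Finset.subset_insert _ _)
      ((card_insert_image_le T x).trans ht)))

theorem avgEntropy_succ_sub_le (hμ : IsSheraliAdams r μ) (hn : Fintype.card V ≠ 0) {t : ℕ}
    (ht : t < r) : avgEntropy μ (t + 1) - avgEntropy μ t ≤ Real.log (Fintype.card A) := by
  have hn' : (Fintype.card V : ℝ) ≠ 0 := by exact_mod_cast hn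
  rw [avgEntropy_succ_sub hn]
  calc _ ≤ ((Fintype.card V : ℝ) ^ (t + 1))⁻¹ * ∑ T : Fin t → V, ∑ x : V,
        Real.log (Fintype.card A) :=
        mul_le_mul_of_nonneg_left (Finset.sum_le_sum fun T _ => Finset.sum_le_sum fun x _ =>
          sub_le_iff_le_add'.2 (hμ.saEntropy_insert_le x ((card_insert_image_le T x).trans ht)))
          (by positivity)
    _ = _ := by
      simp
      field_simp
      ring

theorem exists_average_condTotalCorrelation_le (hμ : IsSheraliAdams r μ)
    (hn : Fintype.card V ≠ 0) {k l : ℕ} (hk : 0 < k) (hl : 0 < l) (hlr : l + k ≤ r) :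
    ∃ t < l, ((Fintype.card V : ℝ) ^ t)⁻¹ * ∑ T : Fin t → V, ((Fintype.card V : ℝ) ^ k)⁻¹ *
        ∑ S : Fin k → V, condTotalCorrelation μ (Finset.image T Finset.univ) S ≤
      (k : ℝ) ^ 2 * Real.log (Fintype.card A) / l := by
  set h : ℕ → ℝ := fun t => avgEntropy μ (t + 1) - avgEntropy μ t with hdef
  set L := Real.log (Fintype.card A)
  have h0 : ∀ t, t < l + k → 0 ≤ h t := fun t ht =>
    hμ.avgEntropy_succ_sub_nonneg hn (by omega)
  have hL : ∀ t, t < l + k → h t ≤ L := fun t ht => hμ.avgEntropy_succ_sub_le hn (by omega)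
  have hL0 : 0 ≤ L := (h0 0 (by omega)).trans (hL 0 (by omega))
  have heq : ∀ t, k * (avgEntropy μ (t + 1) - avgEntropy μ t) -
      (avgEntropy μ (t + k) - avgEntropy μ t) = ∑ i ∈ Finset.range k, (h t - h (t + i)) := by
    intro t
    have h1 := Finset.sum_range_sub (fun i => avgEntropy μ (t + i)) k
    rw [Finset.sum_sub_distrib, Finset.sum_const, Finset.card_range, nsmul_eq_mul]
    rw [add_zero] at h1
    rw [← h1]
    rfl
  have hsum : ∑ t ∈ Finset.range l, (k * (avgEntropy μ (t + 1) - avgEntropy μ t) -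
      (avgEntropy μ (t + k) - avgEntropy μ t)) ≤ ∑ t ∈ Finset.range l, (k : ℝ) ^ 2 * L / l := by
    rw [Finset.sum_congr rfl fun t _ => heq t, Finset.sum_comm]
    have hl' : (l : ℝ) ≠ 0 := by exact_mod_cast hl.ne'
    calc _ ≤ ∑ i ∈ Finset.range k, (k : ℝ) * L := by
          refine Finset.sum_le_sum fun i hi => ?_
          have hik := (Finset.mem_range.1 hi).le
          exact (sum_sub_shift_le h0 hL hik).trans
            (mul_le_mul_of_nonneg_right (by exact_mod_cast hik) hL0)
      _ = _ := by
        simp only [Finset.sum_const, Finset.card_range, nsmul_eq_mul]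
        field_simp
  obtain ⟨t, ht, hle⟩ := Finset.exists_le_of_sum_le (Finset.nonempty_range_iff.2 hl.ne') hsum
  have htl := Finset.mem_range.1 ht
  exact ⟨t, htl, by rwa [hμ.average_condTotalCorrelation_eq hn (by omega)]⟩

end IsSheraliAdams

end Averages

/-- **Total correlation of a conditioned Sherali–Adams solution.**
An `r`-level SA solution of a `Δ`-dense Max `k`-CSP instance is encoded as a family `μ S`
of probability distributions over full assignments `V → A` (one for each `S : Finset V`
with `|S| ≤ r`), whose marginals agree on intersections.  For any `0 < l ≤ r − k` there is
a `t ≤ l` such that, in expectation over a uniformly random `t`-tuple `T` of variables and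
an assignment `ψ` to `T` drawn from the marginal `X_T`, the expected (over `S ∼ W`) total
correlation of the conditioned solution, i.e. the KL divergence of the conditioned joint
distribution of the variables of `S` from the product of the conditioned single-variable
marginals, is at most `k²·log q/(l·Δ)`. -/
theorem conditioned_SA_total_correlation
    {V A : Type*} [Fintype V] [Fintype A] {k r : ℕ}
    (μ : Finset V → (V → A) → ℝ)
    (hμ0 : ∀ S φ, 0 ≤ μ S φ)
    (hμ1 : ∀ S : Finset V, S.card ≤ r → ∑ φ : V → A, μ S φ = 1)
    (hμmarg : ∀ S T : Finset V, S.card ≤ r → T.card ≤ r → ∀ ψ : V → A,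
      (∑ φ : V → A, if ∀ a ∈ S ∩ T, φ a = ψ a then μ S φ else 0) =
        (∑ φ : V → A, if ∀ a ∈ S ∩ T, φ a = ψ a then μ T φ else 0))
    (W : (Fin k → V) → ℝ) (hW0 : ∀ S, 0 ≤ W S) (hW1 : ∑ S : Fin k → V, W S = 1)
    (Δ : ℝ) (hΔ : 0 < Δ)
    (hdense : ∀ S : Fin k → V, Δ * W S ≤ ((Fintype.card V : ℝ) ^ k)⁻¹)
    (l : ℕ) (hl : 0 < l) (hlr : l + k ≤ r) :
    ∃ t : ℕ, t ≤ l ∧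
      (((Fintype.card V : ℝ) ^ t)⁻¹ *
          ∑ T : Fin t → V, ∑ ψ : V → A,
            μ (Finset.image T Finset.univ) ψ *
              ∑ S : Fin k → V, W S *
                klDiv
                  (fun v : Fin k → A =>
                    (∑ φ : V → A,
                        if (∀ i, φ (S i) = v i) ∧ (∀ j, φ (T j) = ψ (T j)) then
                          μ (Finset.image S Finset.univ ∪ Finset.image T Finset.univ) φ
                        else 0) /
                      (∑ φ : V → A,
                        if ∀ j, φ (T j) = ψ (T j) then
                          μ (Finset.image T Finset.univ) φ
                        else 0))
                  (fun v : Fin k → A =>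
                    ∏ i,
                      (∑ φ : V → A,
                          if φ (S i) = v i ∧ (∀ j, φ (T j) = ψ (T j)) then
                            μ (insert (S i) (Finset.image T Finset.univ)) φ
                          else 0) /
                        (∑ φ : V → A,
                          if ∀ j, φ (T j) = ψ (T j) then
                            μ (Finset.image T Finset.univ) φ
                          else 0))) ≤
        (k : ℝ) ^ 2 * Real.log (Fintype.card A) / ((l : ℝ) * Δ) := by
  have hμ : IsSheraliAdams r μ := ⟨hμ0, hμ1, hμmarg⟩
  by_cases hVk : Fintype.card V = 0 ∧ k ≠ 0
  · have : IsEmpty V := Fintype.card_eq_zero_iff.1 hVk.1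
    have : Nonempty (Fin k) := ⟨⟨0, Nat.pos_of_ne_zero hVk.2⟩⟩
    simp at hW1
  have hcard : ∀ {t : ℕ}, t < l → ∀ (T : Fin t → V) (S : Fin k → V),
      (Finset.image S Finset.univ ∪ Finset.image T Finset.univ).card ≤ r :=
    fun ht T S => (card_image_union_image_le T S).trans (by omega)
  have hbound : ∃ t < l, ((Fintype.card V : ℝ) ^ t)⁻¹ * ∑ T : Fin t → V,
      ∑ S : Fin k → V, W S * condTotalCorrelation μ (Finset.image T Finset.univ) S ≤
        (k : ℝ) ^ 2 * Real.log (Fintype.card A) / ((l : ℝ) * Δ) := by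
    rcases Nat.eq_zero_or_pos k with rfl | hk
    · refine ⟨0, hl, le_of_eq ?_⟩
      simp only [hμ.condTotalCorrelation_eq _ _ (hcard hl _ _)]
      simp
    have hn : Fintype.card V ≠ 0 := fun h => hVk ⟨h, hk.ne'⟩
    obtain ⟨t, htl, ht⟩ := hμ.exists_average_condTotalCorrelation_le hn hk hl hlr
    refine ⟨t, htl, ?_⟩
    have hstep : ∀ (T : Fin t → V) (S : Fin k → V),
        W S * condTotalCorrelation μ (Finset.image T Finset.univ) S ≤
          Δ⁻¹ * (((Fintype.card V : ℝ) ^ k)⁻¹ *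
            condTotalCorrelation μ (Finset.image T Finset.univ) S) := by
      intro T S
      rw [← mul_assoc]
      refine mul_le_mul_of_nonneg_right ?_
        (hμ.condTotalCorrelation_nonneg _ _ (hcard htl T S))
      rw [le_inv_mul_iff₀ hΔ]
      exact hdense S
    calc _ ≤ ((Fintype.card V : ℝ) ^ t)⁻¹ * ∑ T : Fin t → V, ∑ S : Fin k → V,
          Δ⁻¹ * (((Fintype.card V : ℝ) ^ k)⁻¹ *
            condTotalCorrelation μ (Finset.image T Finset.univ) S) :=
          mul_le_mul_of_nonneg_left (Finset.sum_le_sum fun T _ =>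
            Finset.sum_le_sum fun S _ => hstep T S) (by positivity)
      _ = Δ⁻¹ * (((Fintype.card V : ℝ) ^ t)⁻¹ * ∑ T : Fin t → V,
          ((Fintype.card V : ℝ) ^ k)⁻¹ * ∑ S : Fin k → V,
            condTotalCorrelation μ (Finset.image T Finset.univ) S) := by
          simp only [← Finset.mul_sum]
          ring
      _ ≤ Δ⁻¹ * ((k : ℝ) ^ 2 * Real.log (Fintype.card A) / l) :=
          mul_le_mul_of_nonneg_left ht (by positivity)
      _ = _ := by field_simp
  obtain ⟨t, htl, ht⟩ := hbound
  refine ⟨t, htl.le, le_of_eq_of_le ?_ ht⟩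
  congr 1
  refine Finset.sum_congr rfl fun T _ => ?_
  simp only [condTotalCorrelation, Finset.mul_sum]
  rw [Finset.sum_comm]
  refine Finset.sum_congr rfl fun S _ => Finset.sum_congr rfl fun ψ _ => ?_
  rw [mul_left_comm]
  congr 3 <;> funext v <;>
    simp only [condLaw, marg, funext_iff, Finset.forall_mem_image, Finset.mem_univ, true_implies]
end
end
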